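/- arXiv:2508.03150 — 2 statements merged into one kernel-verified Lean document; each statement's English description precedes it below -/
import Mathlib

section
/- Desnanot–Jacobi relation for truncated Schur multiple zeta values, column version (Corollary 5.3(2)): Let M be a positive integer, a : ℤ → ℂ, l ≥ 1, and let λ ⊇ μ be partitions with conjugates λ' = (λ'_1,…,λ'_{l+1}) and μ' = (μ'_1,…,μ'_{l+1}) (padded with zeros). Then ζ^M_{(λ'_1,…,λ'_{l+1})'/(μ'_1,…,μ'_{l+1})'}(a) · ζ^M_{(λ'_2,…,λ'_l)'/(μ'_2,…,μ'_l)'}(τ a) = ζ^M_{(λ'_1,…,λ'_l)'/(μ'_1,…,μ'_l)'}(a) · ζ^M_{(λ'_2,…,λ'_{l+1})'/(μ'_2,…,μ'_{l+1})'}(τ a) − ζ^M_{(λ'_2−1,…,λ'_{l+1}−1)'/(μ'_1,…,μ'_l)'}(a) · ζ^M_{(λ'_1+1,…,λ'_l+1)'/(μ'_2,…,μ'_{l+1})'}(τ a), where ν' denotes the conjugate partition, τ := τ^1, and ζ^M_{ν/κ}(·) := 0 whenever ν/κ is not a skew partition. -/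
open Matrix BigOperators Finset Filter

/-- Extend a `Fin N`-indexed matrix to `ℕ` indices by zero. -/
def matExt {R : Type*} [Zero R] {N : ℕ} (U : Matrix (Fin N) (Fin N) R) : ℕ → ℕ → R :=
  fun i j => if hi : i < N then (if hj : j < N then U ⟨i, hi⟩ ⟨j, hj⟩ else 0) else 0

/-- `U` is upper unitriangular. -/
def UpperUni {R : Type*} [Zero R] [One R] {N : ℕ} (U : Matrix (Fin N) (Fin N) R) : Prop :=
  (∀ i, U i i = 1) ∧ ∀ i j : Fin N, (j : ℕ) < (i : ℕ) → U i j = 0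

/-- `L` is lower unitriangular. -/
def LowerUni {R : Type*} [Zero R] [One R] {N : ℕ} (L : Matrix (Fin N) (Fin N) R) : Prop :=
  (∀ i, L i i = 1) ∧ ∀ i j : Fin N, (i : ℕ) < (j : ℕ) → L i j = 0

/-- 0-based entries of the Maya diagram `J(λ;r)` (the `a`-th smallest element, minus 1):
for `a = 0,…,r-1` this is `λ_{r-a} + a` (with `λ` 0-based). -/
def maya (lam : ℕ → ℕ) (r : ℕ) (a : Fin r) : ℕ := lam (r - 1 - (a : ℕ)) + (a : ℕ)

/-- The ninth variation of the skew Schur function `S^{(r)}_{λ/μ}(U)`: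
the minor of `U` on rows `J(μ;r)` and columns `J(λ;r)`. -/
def SchurV {R : Type*} [CommRing R] {N : ℕ} (U : Matrix (Fin N) (Fin N) R)
    (r : ℕ) (lam mu : ℕ → ℕ) : R :=
  Matrix.det (Matrix.of fun i j : Fin r => matExt U (maya mu r i) (maya lam r j))

/-- Conjugate partition (0-based), counting parts among indices `< B`. -/
def conjF (f : ℕ → ℕ) (B : ℕ) : ℕ → ℕ :=
  fun i => ((Finset.range B).filter fun j => i + 1 ≤ f j).card

/-- The hook partition `(a+1, 1^b)` (0-based function). -/
def hookP (a b : ℕ) : ℕ → ℕ := fun k => if k = 0 then a + 1 else if k ≤ b then 1 else 0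

/-- `h^{(r)}_d(U) = S^{(r)}_{(d)}(U)`, zero for `d < 0`. -/
def hSV {R : Type*} [CommRing R] {N : ℕ} (U : Matrix (Fin N) (Fin N) R) (r : ℕ) (d : ℤ) : R :=
  if 0 ≤ d then SchurV U r (fun k => if k = 0 then d.toNat else 0) (fun _ => 0) else 0

/-- `e^{(r)}_d(U) = S^{(r)}_{(1^d)}(U)`, zero for `d < 0`. -/
def eSV {R : Type*} [CommRing R] {N : ℕ} (U : Matrix (Fin N) (Fin N) R) (r : ℕ) (d : ℤ) : R :=
  if 0 ≤ d then SchurV U r (fun k => if k < d.toNat then 1 else 0) (fun _ => 0) else 0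

/-- The partition with Frobenius coordinates `(a|b)` (all 0-based as functions). -/
def frobP (p : ℕ) (a b : Fin p → ℕ) : ℕ → ℕ :=
  fun i => if h : i < p then a ⟨i, h⟩ + i + 1
    else (Finset.univ.filter fun j : Fin p => i < b j + (j : ℕ) + 1).card

/-- `f : ℕ → ℤ` is a partition of length `≤ B`. -/
def IsPartZ (B : ℕ) (f : ℕ → ℤ) : Prop :=
  (∀ i, f (i + 1) ≤ f i) ∧ (∀ i, 0 ≤ f i) ∧ (∀ i, B ≤ i → f i = 0)

/-- `lam/mu` is a skew partition (of length `≤ B`). -/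
def IsSkewZ (B : ℕ) (lam mu : ℕ → ℤ) : Prop :=
  IsPartZ B lam ∧ IsPartZ B mu ∧ ∀ i, mu i ≤ lam i

open Classical in
/-- `S^{(r)}_{λ/μ}(U)` with the convention that it is `0` if `λ/μ` is not a skew partition. -/
noncomputable def SchurVz {R : Type*} [CommRing R] {N : ℕ} (U : Matrix (Fin N) (Fin N) R)
    (r B : ℕ) (lam mu : ℕ → ℤ) : R :=
  if IsSkewZ B lam mu then SchurV U r (fun i => (lam i).toNat) (fun i => (mu i).toNat) else 0

open Classical in
/-- `S^{(r)}_{λ'/μ'}(U)` applied to the conjugates, with the zero convention. -/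
noncomputable def SchurVzConj {R : Type*} [CommRing R] {N : ℕ} (U : Matrix (Fin N) (Fin N) R)
    (r B : ℕ) (lam mu : ℕ → ℤ) : R :=
  if IsSkewZ B lam mu then
    SchurV U r (conjF (fun i => (lam i).toNat) B) (conjF (fun i => (mu i).toNat) B) else 0

/-- `lam/mu` is a skew partition (ℕ-valued version). -/
def IsSkewN (B : ℕ) (lam mu : ℕ → ℕ) : Prop :=
  (∀ i, lam (i + 1) ≤ lam i) ∧ (∀ i, mu (i + 1) ≤ mu i) ∧ (∀ i, mu i ≤ lam i) ∧
    (∀ i, B ≤ i → lam i = 0)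

open Classical in
noncomputable def SchurVn {R : Type*} [CommRing R] {N : ℕ} (U : Matrix (Fin N) (Fin N) R)
    (r B : ℕ) (lam mu : ℕ → ℕ) : R :=
  if IsSkewN B lam mu then SchurV U r lam mu else 0

/-- The rectangular partition `[m|n] = (n^m)`. -/
def rectP (m n : ℕ) : ℕ → ℕ := fun i => if i < m then n else 0

/-- `[m|n]^l = ((n+1)^l, n^{m-l})`. -/
def rectUpP (m n l : ℕ) : ℕ → ℕ := fun i => if i < l then n + 1 else if i < m then n else 0

/-- `[m|n]_k = (n^m, k)`. -/
def rectLowP (m n k : ℕ) : ℕ → ℕ := fun i => if i < m then n else if i = m then k else 0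

/-- `E + c·E_{t,t+1}` (indices 0-based). -/
def elemMat {R : Type*} [CommRing R] (N t : ℕ) (c : R) : Matrix (Fin N) (Fin N) R :=
  1 + Matrix.of (fun i j : Fin N => if (i : ℕ) = t ∧ (j : ℕ) = t + 1 then c else 0)

/-- `U = U_1 ⋯ U_M` with `U_k = (E + w_{k,1-r}E_{1,2}) ⋯ (E + w_{k,N-1-r}E_{N-1,N})`. -/
def UmatW {R : Type*} [CommRing R] (N M : ℕ) (r : ℤ) (w : ℕ → ℤ → R) :
    Matrix (Fin N) (Fin N) R :=
  ((List.range M).map fun k =>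
    ((List.range (N - 1)).map fun t => elemMat N t (w (k + 1) ((t : ℤ) + 1 - r))).prod).prod

/-- The partition `(m_1^{r_1} m_2^{r_2-r_1} ⋯ m_n^{r_n-r_{n-1}})` (corner data 0-based). -/
def stepPart (n : ℕ) (m rr : ℕ → ℕ) : ℕ → ℕ :=
  fun i =>
    if h : (((Finset.range n).filter fun j => i < rr j)).Nonempty then
      m (((Finset.range n).filter fun j => i < rr j).min' h)
    else 0

/-- `Add_{a,b}` (rows 1-based in `a`, `b`; the function argument is 0-based). -/
def AddOp (a b : ℕ) (k : ℕ → ℕ) : ℕ → ℕ := fun i =>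
  if i + 1 ≤ a then k i
  else if i + 1 = a + 1 then k (a - 1)
  else if i + 1 ≤ b + 1 then k (i - 1) + 1
  else k i

/-- `Rem_{a,b}`. -/
def RemOp (a b : ℕ) (k : ℕ → ℕ) : ℕ → ℕ := fun i =>
  if i + 1 < a then k i
  else if i + 1 ≤ b - 1 then k (i + 1) - 1
  else if i + 1 = b then k b
  else k i

/-- `op_{a 0, b 0} ∘ op_{a 1, b 1} ∘ ⋯ ∘ op_{a (t-1), b (t-1)}` applied to `k`. -/
def iterOp (op : ℕ → ℕ → (ℕ → ℕ) → ℕ → ℕ) (t : ℕ) (a b : ℕ → ℕ) (k : ℕ → ℕ) : ℕ → ℕ :=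
  (List.range t).foldr (fun i acc => op (a i) (b i) acc) k

/-- the `i`-th smallest element of a finite set of naturals (0-based). -/
def ascNth (s : Finset ℕ) (i : ℕ) : ℕ := (s.sort (· ≤ ·)).getD i 0

/-- The cells of the skew Young diagram `D(λ/μ)` (0-based, rows `< B`). -/
def cellsD (B : ℕ) (lam mu : ℕ → ℕ) : Finset (ℕ × ℕ) :=
  (Finset.range B ×ˢ Finset.range (lam 0 + 1)).filter fun p => mu p.1 ≤ p.2 ∧ p.2 < lam p.1

/-- Semistandardness: weakly increasing along rows, strictly increasing down columns. -/
def IsSSYT {M B : ℕ} {lam mu : ℕ → ℕ} (T : ↥(cellsD B lam mu) → Fin M) : Prop :=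
  (∀ c c' : ↥(cellsD B lam mu), c.val.1 = c'.val.1 → c.val.2 ≤ c'.val.2 → T c ≤ T c') ∧
  (∀ c c' : ↥(cellsD B lam mu), c.val.1 < c'.val.1 → c.val.2 = c'.val.2 → T c < T c')

open Classical in
/-- Sum over all semistandard tableaux of shape `λ/μ` with entries in `{1,…,M}` of
the product over cells `c` of `f (entry) c`. -/
noncomputable def tabSum {R : Type*} [CommRing R] (M B : ℕ) (lam mu : ℕ → ℕ)
    (f : ℕ → ℕ × ℕ → R) : R :=
  ∑ T ∈ Finset.univ.filter (fun T : ↥(cellsD B lam mu) → Fin M => IsSSYT T),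
    ∏ c : ↥(cellsD B lam mu), f ((T c : ℕ) + 1) c.val

/-- `M`-truncated Schur multiple zeta value for a general filling `s` of the diagram. -/
noncomputable def zetaTF (M B : ℕ) (lam mu : ℕ → ℕ) (s : ℕ × ℕ → ℂ) : ℂ :=
  tabSum M B lam mu fun k c => (k : ℂ) ^ (-(s c))

/-- `M`-truncated diagonally constant Schur multiple zeta value `ζ^M_{λ/μ}(a)`. -/
noncomputable def zetaT (M B : ℕ) (lam mu : ℕ → ℕ) (a : ℤ → ℂ) : ℂ :=
  zetaTF M B lam mu fun c => a ((c.2 : ℤ) - (c.1 : ℤ))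

open Classical in
/-- `ζ^M_{λ/μ}(a)` with the zero convention for non-skew shapes. -/
noncomputable def zetaZ (M B : ℕ) (lam mu : ℕ → ℤ) (a : ℤ → ℂ) : ℂ :=
  if IsSkewZ B lam mu then
    zetaT M B (fun i => (lam i).toNat) (fun i => (mu i).toNat) a else 0

open Classical in
/-- `ζ^M_{λ'/μ'}(a)` applied to conjugates, with the zero convention. -/
noncomputable def zetaZConj (M B : ℕ) (lam mu : ℕ → ℤ) (a : ℤ → ℂ) : ℂ :=
  if IsSkewZ B lam mu then
    zetaT M (lam 0).toNat (conjF (fun i => (lam i).toNat) B)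
      (conjF (fun i => (mu i).toNat) B) a
  else 0

open Classical in
/-- `M`-truncated multiple zeta-star value `ζ^{⋆,M}(s_0,…,s_{d-1})`. -/
noncomputable def zetaStarT (M d : ℕ) (s : ℕ → ℂ) : ℂ :=
  ∑ f ∈ Finset.univ.filter (fun f : Fin d → Fin M => ∀ i j : Fin d, i ≤ j → f i ≤ f j),
    ∏ i : Fin d, (((f i : ℕ) + 1 : ℕ) : ℂ) ^ (-(s i))

open Classical in
/-- `M`-truncated multiple zeta value `ζ^{M}(s_0,…,s_{d-1})`. -/
noncomputable def zetaMT (M d : ℕ) (s : ℕ → ℂ) : ℂ :=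
  ∑ f ∈ Finset.univ.filter (fun f : Fin d → Fin M => ∀ i j : Fin d, i < j → f i < f j),
    ∏ i : Fin d, (((f i : ℕ) + 1 : ℕ) : ℂ) ^ (-(s i))

/-- The Riemann zeta value `ζ(k) = Σ_{n ≥ 1} n^{-k}`. -/
noncomputable def zetaVal (k : ℕ) : ℂ := ∑' n : ℕ, ((n + 1 : ℕ) : ℂ) ^ (-(k : ℤ))

/-- `ζ^⋆(1,k) = Σ_{1 ≤ m ≤ n} m^{-1} n^{-k}`. -/
noncomputable def zetaStarOne (k : ℕ) : ℂ :=
  ∑' n : ℕ, (∑ m ∈ Finset.Icc 1 (n + 1), ((m : ℂ))⁻¹) * ((n + 1 : ℕ) : ℂ) ^ (-(k : ℤ))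


theorem dj_aux {R : Type*} [CommRing R] [IsDomain R] {m : ℕ} (A : Matrix (Fin 2 ⊕ Fin m) (Fin 2 ⊕ Fin m) R)
    (hA : A.det ≠ 0) :
    (A.adjugate.toBlocks₁₁).det = A.det * (A.toBlocks₂₂).det := by
  have h1 : A * fromBlocks A.adjugate.toBlocks₁₁ 0 A.adjugate.toBlocks₂₁ 1
      = fromBlocks (A.det • 1) A.toBlocks₁₂ 0 A.toBlocks₂₂ := by
    have h := A.mul_adjugate
    generalize A.adjugate = B at h ⊢
    generalize A.det = d at h ⊢
    rw [← fromBlocks_toBlocks B, ← fromBlocks_one, fromBlocks_smul] at h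
    conv_lhs at h => rw [← fromBlocks_toBlocks A]
    conv_lhs => rw [← fromBlocks_toBlocks A]
    rw [fromBlocks_multiply] at h ⊢
    rw [fromBlocks_inj] at h
    obtain ⟨h1, -, h3, -⟩ := h
    rw [h1, h3]
    simp
  have h2 := congrArg Matrix.det h1
  rw [det_mul, det_fromBlocks_zero₁₂, det_fromBlocks_zero₂₁, det_smul] at h2
  simp only [det_one, mul_one, Fintype.card_fin] at h2
  apply mul_left_cancel₀ hA
  rw [h2]; ring

theorem dj_aux2 {R : Type*} [CommRing R] {m : ℕ} (A : Matrix (Fin 2 ⊕ Fin m) (Fin 2 ⊕ Fin m) R) :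
    (A.adjugate.toBlocks₁₁).det = A.det * (A.toBlocks₂₂).det := by
  have h := dj_aux (mvPolynomialX (Fin 2 ⊕ Fin m) (Fin 2 ⊕ Fin m) ℤ) (det_mvPolynomialX_ne_zero _ _)
  let f : MvPolynomial ((Fin 2 ⊕ Fin m) × (Fin 2 ⊕ Fin m)) ℤ →+* R :=
    MvPolynomial.eval₂Hom (Int.castRingHom R) fun p => A p.1 p.2
  have hf : f.mapMatrix (mvPolynomialX (Fin 2 ⊕ Fin m) (Fin 2 ⊕ Fin m) ℤ) = A := by
    ext i j; simp [f]
  have h' := congrArg f h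
  rw [map_mul, f.map_det, f.map_det, f.map_det, hf] at h'
  have e1 : ∀ X : Matrix (Fin 2 ⊕ Fin m) (Fin 2 ⊕ Fin m) _, f.mapMatrix X.toBlocks₁₁ = (f.mapMatrix X).toBlocks₁₁ :=
    fun X => rfl
  have e2 : ∀ X : Matrix (Fin 2 ⊕ Fin m) (Fin 2 ⊕ Fin m) _, f.mapMatrix X.toBlocks₂₂ = (f.mapMatrix X).toBlocks₂₂ :=
    fun X => rfl
  rw [e1, e2, f.map_adjugate, hf] at h'
  exact h'

def djMap (m : ℕ) : Fin 2 ⊕ Fin m → Fin (m + 2) :=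
  Sum.elim (fun i => if i = 0 then 0 else Fin.last _) (fun i => i.succ.castSucc)

theorem djMap_bij (m : ℕ) : Function.Bijective (djMap m) := by
  rw [Fintype.bijective_iff_injective_and_card]
  refine ⟨?_, by simp [add_comm]⟩
  have v0 : ((djMap m (Sum.inl 0) : Fin (m+2)) : ℕ) = 0 := rfl
  have v1 : ((djMap m (Sum.inl 1) : Fin (m+2)) : ℕ) = m + 1 := rfl
  have v2 : ∀ i, ((djMap m (Sum.inr i) : Fin (m+2)) : ℕ) = i + 1 := fun i => rfl
  intro x y h
  replace h := congrArg Fin.val h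
  have c : ∀ x : Fin 2 ⊕ Fin m, x = Sum.inl 0 ∨ x = Sum.inl 1 ∨ ∃ i, x = Sum.inr i := by
    rintro (i | i)
    · fin_cases i <;> simp
    · exact Or.inr (Or.inr ⟨i, rfl⟩)
  rcases c x with rfl | rfl | ⟨i, rfl⟩ <;> rcases c y with rfl | rfl | ⟨j, rfl⟩ <;>
    simp only [v0, v1, v2] at h
  all_goals first
    | rfl
    | (exfalso; omega)
    | (congr 1; apply Fin.ext; omega)

/-- Desnanot-Jacobi. -/
theorem desnanot_jacobi {R : Type*} [CommRing R] {m : ℕ} (A : Matrix (Fin (m+2)) (Fin (m+2)) R) :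
    A.det * (A.submatrix (fun i : Fin m => i.succ.castSucc) (fun i : Fin m => i.succ.castSucc)).det =
    (A.submatrix (Fin.castSucc : Fin (m+1) → _) Fin.castSucc).det * (A.submatrix Fin.succ Fin.succ).det
    - (A.submatrix Fin.castSucc Fin.succ).det * (A.submatrix Fin.succ Fin.castSucc).det := by
  let e := Equiv.ofBijective _ (djMap_bij m)
  have h := dj_aux2 (A.submatrix e e)
  rw [det_submatrix_equiv_self, adjugate_submatrix_equiv_self] at h
  have e0 : e (Sum.inl 0) = 0 := rfl
  have e1 : e (Sum.inl 1) = Fin.last _ := rfl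
  rw [det_fin_two] at h
  simp only [toBlocks₁₁, of_apply, submatrix_apply, e0, e1, adjugate_fin_succ_eq_det_submatrix] at h
  have hz : (0 : Fin (m+2)).succAbove = Fin.succ := by ext i; simp
  have hl : (Fin.last (m+1)).succAbove = Fin.castSucc := by ext i; simp
  rw [hz, hl] at h
  have e3 : ((A.submatrix e e).toBlocks₂₂) = A.submatrix (fun i : Fin m => i.succ.castSucc) (fun i : Fin m => i.succ.castSucc) := rfl
  rw [e3] at h
  rw [← h]
  simp only [Fin.val_zero, Fin.val_last, add_zero, zero_add, pow_zero, one_mul]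
  have h1 : ((-1 : R) ^ (m+1)) * (-1) ^ (m+1) = 1 := by
    rw [← pow_add]; exact Even.neg_one_pow ⟨_, rfl⟩
  have h2 : ((-1 : R) ^ (m+1 + (m+1)))  = 1 := by
    exact Even.neg_one_pow ⟨_, rfl⟩
  rw [h2]
  linear_combination (-(A.submatrix Fin.castSucc Fin.succ).det * (A.submatrix Fin.succ Fin.castSucc).det) * h1

/-- Elementary-type entries. -/
def eP {R : Type*} [CommRing R] (x : ℕ → ℤ → R) : ℕ → ℤ → ℤ → R
  | 0, p, q => if p = q then 1 else 0
  | M + 1, p, q => eP x M p q + x (M + 1) q * eP x M p (q - 1)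

theorem eP_zero_of_lt {R : Type*} [CommRing R] (x : ℕ → ℤ → R) (M : ℕ) :
    ∀ p q : ℤ, q < p → eP x M p q = 0 := by
  induction M with
  | zero => intro p q h; simp only [eP]; rw [if_neg (by omega)]
  | succ M ih =>
    intro p q h
    simp only [eP]
    rw [ih p q h, ih p (q-1) (by omega)]; simp

def dE {R : Type*} [CommRing R] (x : ℕ → ℤ → R) {N : ℕ} (M : ℕ) (p q : Fin N → ℤ) : R :=
  Matrix.det (Matrix.of fun i j : Fin N => eP x M (p i) (q j))

def decS {N : ℕ} (S : Finset (Fin N)) (q : Fin N → ℤ) : Fin N → ℤ :=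
  fun j => if j ∈ S then q j - 1 else q j

theorem dE_succ {R : Type*} [CommRing R] (x : ℕ → ℤ → R) {N : ℕ} (M : ℕ) (p q : Fin N → ℤ) :
    dE x (M + 1) p q =
      ∑ S : Finset (Fin N), (∏ j ∈ S, x (M + 1) (q j)) * dE x M p (decS S q) := by
  unfold dE
  rw [← det_transpose]
  have h := (detRowAlternating (R := R) (n := Fin N)).toMultilinearMap.map_add_univ
    (fun j i => x (M + 1) (q j) * eP x M (p i) (q j - 1)) (fun j i => eP x M (p i) (q j))
  have e : (of fun i j : Fin N => eP x (M+1) (p i) (q j))ᵀ = 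
    (fun j i => x (M + 1) (q j) * eP x M (p i) (q j - 1)) + (fun j i => eP x M (p i) (q j)) := by
    ext i j
    simp [eP, add_comm]
  rw [e]
  refine h.trans (Finset.sum_congr rfl fun S _ => ?_)
  have h2 := det_mul_row (fun j => if j ∈ S then x (M+1) (q j) else 1)
    (of fun i j : Fin N => eP x M (p i) (decS S q j))
  rw [← det_transpose] at h2
  rw [Finset.prod_ite_mem, Finset.univ_inter] at h2
  rw [← h2]
  show Matrix.det _ = _
  congr 1
  ext i j
  by_cases hi : i ∈ S <;> simp [Finset.piecewise, hi, decS]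

theorem det_zero_block {R : Type*} [CommRing R] {N : ℕ} (A : Matrix (Fin N) (Fin N) R) (k : Fin N)
    (h : ∀ i j, i ≤ k → k ≤ j → A i j = 0) : A.det = 0 := by
  rw [← det_transpose, det_apply]
  refine Finset.sum_eq_zero fun σ _ => ?_
  suffices hs : ∃ i, i ≤ k ∧ k ≤ σ i by
    obtain ⟨i, h1, h2⟩ := hs
    rw [Finset.prod_eq_zero (Finset.mem_univ i), smul_zero]
    exact h _ _ h1 h2
  by_contra hc
  push Not at hc
  have : (Finset.Iic k).card ≤ (Finset.Iio k).card :=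
    Finset.card_le_card_of_injOn σ (fun i hi => by simpa using hc i (by simpa using hi))
      σ.injective.injOn
  simp at this

theorem dE_zero_of_lt {R : Type*} [CommRing R] (x : ℕ → ℤ → R) {N : ℕ} (M : ℕ) (p q : Fin N → ℤ)
    (hp : Antitone p) (hq : Antitone q) (k : Fin N) (hk : q k < p k) : dE x M p q = 0 := by
  refine det_zero_block _ k fun i j hi hj => eP_zero_of_lt _ _ _ _ ?_
  have := hp hi
  have := hq hj
  omega

theorem dE_zero_of_eq {R : Type*} [CommRing R] (x : ℕ → ℤ → R) {N : ℕ} (M : ℕ) (p q : Fin N → ℤ)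
    (i j : Fin N) (hij : i ≠ j) (h : q i = q j) : dE x M p q = 0 := by
  refine det_zero_of_column_eq hij fun k => ?_
  simp [h]

theorem dE_base_ne {R : Type*} [CommRing R] (x : ℕ → ℤ → R) {N : ℕ} (p q : Fin N → ℤ)
    (hp : Antitone p) (hq : Antitone q) (k : Fin N) (hk : p k < q k) : dE x 0 p q = 0 := by
  unfold dE
  rw [← det_transpose]
  refine det_zero_block _ k fun i j hi hj => ?_
  have := hq hi
  have := hp hj
  simp only [transpose_apply, of_apply, eP]
  rw [if_neg (by omega)]

theorem dE_base_eq {R : Type*} [CommRing R] (x : ℕ → ℤ → R) {N : ℕ} (p : Fin N → ℤ)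
    (hp : Function.Injective p) : dE x 0 p p = 1 := by
  unfold dE
  convert det_one (R := R) (n := Fin N)
  ext i j
  simp [eP, Matrix.one_apply, hp.eq_iff]

/-- Semistandard condition on a general finite cell set. -/
def SSTC {M : ℕ} {C : Finset (ℕ × ℕ)} (T : ↥C → Fin M) : Prop :=
  (∀ c c' : ↥C, c.val.1 = c'.val.1 → c.val.2 ≤ c'.val.2 → T c ≤ T c') ∧
  (∀ c c' : ↥C, c.val.1 < c'.val.1 → c.val.2 = c'.val.2 → T c < T c')

open Classical in
noncomputable def tabC {R : Type*} [CommRing R] (M : ℕ) (C : Finset (ℕ × ℕ))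
    (f : ℕ → ℕ × ℕ → R) : R :=
  ∑ T ∈ Finset.univ.filter (fun T : ↥C → Fin M => SSTC T),
    ∏ c : ↥C, f ((T c : ℕ) + 1) c.val

def validC (C D : Finset (ℕ × ℕ)) : Prop :=
  (∀ c ∈ D, ∀ c' ∈ C, c.1 = c'.1 → c.2 ≤ c'.2 → c' ∈ D) ∧
  (∀ c ∈ D, ∀ c' ∈ C, c.1 < c'.1 → c.2 = c'.2 → False)

def topD {M : ℕ} {C : Finset (ℕ × ℕ)} (T : ↥C → Fin (M + 1)) : Finset (ℕ × ℕ) :=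
  (Finset.univ.filter fun c : ↥C => T c = Fin.last M).map (Function.Embedding.subtype _)

theorem mem_topD {M : ℕ} {C : Finset (ℕ × ℕ)} (T : ↥C → Fin (M + 1)) (c : ℕ × ℕ) :
    c ∈ topD T ↔ ∃ h : c ∈ C, T ⟨c, h⟩ = Fin.last M := by
  simp [topD]

theorem topD_sub {M : ℕ} {C : Finset (ℕ × ℕ)} (T : ↥C → Fin (M + 1)) : topD T ⊆ C := by
  intro c hc; rw [mem_topD] at hc; exact hc.1

def extT {M : ℕ} {C : Finset (ℕ × ℕ)} (D : Finset (ℕ × ℕ)) (T : ↥(C \ D) → Fin M) : ↥C → Fin (M + 1) :=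
  fun c => if h : c.val ∈ D then Fin.last M else (T ⟨c.val, by simp [h]⟩).castSucc

open Classical in
theorem tabC_succ {R : Type*} [CommRing R] (M : ℕ) (C : Finset (ℕ × ℕ)) (f : ℕ → ℕ × ℕ → R) :
    tabC (M + 1) C f =
      ∑ D ∈ C.powerset.filter (fun D => validC C D), (∏ c ∈ D, f (M + 1) c) * tabC M (C \ D) f := by
  unfold tabC
  rw [← Finset.sum_fiberwise_of_maps_to (g := topD) (t := C.powerset.filter (fun D => validC C D))]
  · refine Finset.sum_congr rfl fun D hD => ?_
    simp only [Finset.mem_filter, Finset.mem_powerset] at hD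
    obtain ⟨hDC, hv⟩ := hD
    rw [Finset.mul_sum]
    symm
    refine Finset.sum_bij (fun T _ => extT D T) ?_ ?_ ?_ ?_
    · intro T hT
      simp only [Finset.mem_filter, Finset.mem_univ, true_and] at hT ⊢
      refine ⟨⟨?_, ?_⟩, ?_⟩
      · intro c c' h1 h2
        unfold extT
        by_cases hc : c.val ∈ D
        · have := hv.1 _ hc _ c'.2 h1 h2
          simp [hc, this]
        · by_cases hc' : c'.val ∈ D
          · simp [hc', Fin.le_last]
          · simp only [hc, hc', dif_neg, not_false_iff]
            rw [Fin.castSucc_le_castSucc_iff]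
            exact hT.1 _ _ h1 h2
      · intro c c' h1 h2
        unfold extT
        by_cases hc : c.val ∈ D
        · exact (hv.2 _ hc _ c'.2 h1 h2).elim
        · by_cases hc' : c'.val ∈ D
          · simp [hc', hc, Fin.castSucc_lt_last]
          · simp only [hc, hc', dif_neg, not_false_iff]
            rw [Fin.castSucc_lt_castSucc_iff]
            exact hT.2 _ _ h1 h2
      · ext c
        rw [mem_topD]
        unfold extT
        constructor
        · rintro ⟨h, h2⟩
          by_contra hc
          simp only [hc, dif_neg, not_false_iff] at h2
          exact (Fin.castSucc_lt_last _).ne h2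
        · intro h
          exact ⟨hDC h, by simp [h]⟩
    · intro T _ T' _ h
      ext c
      have hc := (Finset.mem_sdiff.1 c.2)
      have := congrFun h ⟨c.val, hc.1⟩
      simp only [extT, hc.2, dif_neg, not_false_iff] at this
      have := congrArg Fin.val this
      simpa using this
    · intro T hT
      simp only [Finset.mem_filter, Finset.mem_univ, true_and] at hT
      obtain ⟨hT, hTD⟩ := hT
      have hlt : ∀ c : ↥(C \ D), ((T ⟨c.val, (Finset.mem_sdiff.1 c.2).1⟩ : Fin (M+1)) : ℕ) < M := by
        intro c
        have hc := (Finset.mem_sdiff.1 c.2)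
        have h2 : ¬ (T ⟨c.val, hc.1⟩ = Fin.last M) := by
          intro h
          exact hc.2 (hTD ▸ (mem_topD T c.val).2 ⟨hc.1, h⟩)
        have := Fin.val_lt_last h2
        simpa using this
      refine ⟨fun c => ⟨_, hlt c⟩, ?_, ?_⟩
      · simp only [Finset.mem_filter, Finset.mem_univ, true_and]
        refine ⟨?_, ?_⟩
        · intro c c' h1 h2
          have := hT.1 ⟨c.val, (Finset.mem_sdiff.1 c.2).1⟩ ⟨c'.val, (Finset.mem_sdiff.1 c'.2).1⟩ h1 h2
          simpa using this
        · intro c c' h1 h2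
          have := hT.2 ⟨c.val, (Finset.mem_sdiff.1 c.2).1⟩ ⟨c'.val, (Finset.mem_sdiff.1 c'.2).1⟩ h1 h2
          simpa using this
      · funext c
        unfold extT
        by_cases hc : c.val ∈ D
        · simp only [hc, dif_pos]
          rw [← hTD, mem_topD] at hc
          exact hc.2.symm
        · simp only [hc, dif_neg, not_false_iff]
          rfl
    · intro T hT
      let g : ℕ × ℕ → R := fun c => if h : c ∈ C then f ((extT D T ⟨c, h⟩ : ℕ) + 1) c else 1
      have h1 : ∏ c : ↥C, f ((extT D T c : ℕ) + 1) c.val = ∏ c ∈ C, g c := by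
        rw [← Finset.prod_coe_sort C g]
        refine Finset.prod_congr rfl fun c _ => ?_
        simp [g]
      have h2 : ∏ c : ↥(C \ D), f ((T c : ℕ) + 1) c.val = ∏ c ∈ C \ D, g c := by
        rw [← Finset.prod_coe_sort (C \ D) g]
        refine Finset.prod_congr rfl fun c _ => ?_
        have hc := (Finset.mem_sdiff.1 c.2)
        simp [g, hc.1, extT, hc.2]
      have h3 : ∏ c ∈ D, f (M + 1) c = ∏ c ∈ D, g c := by
        refine Finset.prod_congr rfl fun c hc => ?_
        simp [g, hDC hc, extT, hc]
      rw [h1, h2, h3, mul_comm, Finset.prod_sdiff hDC]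
  · intro T hT
    simp only [Finset.mem_filter, Finset.mem_univ, true_and, Finset.mem_powerset] at hT ⊢
    refine ⟨topD_sub T, ?_, ?_⟩
    · intro c hc c' hc' h1 h2
      rw [mem_topD] at hc ⊢
      obtain ⟨h, hc⟩ := hc
      refine ⟨hc', ?_⟩
      have := hT.1 ⟨c, h⟩ ⟨c', hc'⟩ h1 h2
      rw [hc] at this
      exact Fin.last_le_iff.1 this
    · intro c hc c' hc' h1 h2
      rw [mem_topD] at hc
      obtain ⟨h, hc⟩ := hc
      have := hT.2 ⟨c, h⟩ ⟨c', hc'⟩ h1 h2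
      rw [hc] at this
      exact absurd this (Fin.le_last _).not_gt

theorem tabC_zero {R : Type*} [CommRing R] (C : Finset (ℕ × ℕ)) (f : ℕ → ℕ × ℕ → R) :
    tabC 0 C f = if C = ∅ then 1 else 0 := by
  classical
  unfold tabC
  split_ifs with h
  · subst h
    rw [Finset.filter_true_of_mem]
    · simp
    · intro T _
      exact ⟨fun c => absurd c.2 (Finset.notMem_empty _), fun c => absurd c.2 (Finset.notMem_empty _)⟩
  · obtain ⟨c, hc⟩ := Finset.nonempty_iff_ne_empty.2 h
    apply Finset.sum_eq_zero
    intro T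
    exact (T ⟨c, hc⟩).elim0

/-- Cells of the skew diagram with column intervals `[Μ j, Λ j)`. -/
def colC {N : ℕ} (Lam Mu : Fin N → ℤ) : Finset (ℕ × ℕ) :=
  Finset.univ.biUnion fun j : Fin N =>
    (Finset.Ico (Mu j).toNat (Lam j).toNat).image fun i => (i, (j : ℕ))

theorem mem_colC {N : ℕ} (Lam Mu : Fin N → ℤ) (h0 : ∀ j, 0 ≤ Mu j) (c : ℕ × ℕ) :
    c ∈ colC Lam Mu ↔ ∃ j : Fin N, Mu j ≤ c.1 ∧ (c.1 : ℤ) < Lam j ∧ c.2 = j := by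
  obtain ⟨c1, c2⟩ := c
  simp only [colC, Finset.mem_biUnion, Finset.mem_univ, true_and, Finset.mem_image, Finset.mem_Ico,
    Prod.mk.injEq]
  constructor
  · rintro ⟨j, i, ⟨h1, h2⟩, rfl, rfl⟩
    have := h0 j
    exact ⟨j, by omega, by omega, rfl⟩
  · rintro ⟨j, h1, h2, h3⟩
    have := h0 j
    exact ⟨j, c1, by omega, rfl, h3.symm⟩

theorem mem_colC' {N : ℕ} (Lam Mu : Fin N → ℤ) (h0 : ∀ j, 0 ≤ Mu j) (i : ℕ) (j : Fin N) :
    (i, (j : ℕ)) ∈ colC Lam Mu ↔ Mu j ≤ i ∧ (i : ℤ) < Lam j := by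
  rw [mem_colC _ _ h0]
  constructor
  · rintro ⟨k, h1, h2, h3⟩
    have : j = k := Fin.ext h3
    subst this
    exact ⟨h1, h2⟩
  · rintro ⟨h1, h2⟩
    exact ⟨j, h1, h2, rfl⟩

def posZ {N : ℕ} (s : ℤ) (Lam : Fin N → ℤ) : Fin N → ℤ := fun j => Lam j - (j : ℕ) - s

theorem posZ_anti {N : ℕ} (s : ℤ) (Lam : Fin N → ℤ) (h : Antitone Lam) : Antitone (posZ s Lam) := by
  intro i j hij
  have := h hij
  have : (i : ℕ) ≤ j := hij
  simp only [posZ]; omega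

theorem posZ_strict {N : ℕ} (s : ℤ) (Lam : Fin N → ℤ) (h : Antitone Lam) :
    StrictAnti (posZ s Lam) := by
  intro i j hij
  have := h hij.le
  have : (i : ℕ) < j := hij
  simp only [posZ]; omega

theorem decS_posZ {N : ℕ} (s : ℤ) (Lam : Fin N → ℤ) (S : Finset (Fin N)) :
    decS S (posZ s Lam) = posZ s (decS S Lam) := by
  funext j
  simp only [decS, posZ]
  split_ifs <;> ring

theorem posZ_decS_anti {N : ℕ} (s : ℤ) (Lam : Fin N → ℤ) (h : Antitone Lam) (S : Finset (Fin N)) :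
    Antitone (posZ s (decS S Lam)) := by
  intro i j hij
  rcases hij.eq_or_lt with rfl | hlt
  · exact le_rfl
  · have := h hij
    have : (i : ℕ) < j := hlt
    simp only [posZ, decS]
    split_ifs <;> omega

def goodS {N : ℕ} (Lam Mu : Fin N → ℤ) (S : Finset (Fin N)) : Prop :=
  Antitone (decS S Lam) ∧ ∀ j, Mu j ≤ decS S Lam j

theorem fin_antitone_of_succ {N : ℕ} (g : Fin N → ℤ)
    (h : ∀ i j : Fin N, (j : ℕ) = i + 1 → g j ≤ g i) : Antitone g := by
  have key : ∀ n : ℕ, ∀ i j : Fin N, (j : ℕ) = i + n → g j ≤ g i := by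
    intro n
    induction n with
    | zero => intro i j hij; have : j = i := Fin.ext hij; rw [this]
    | succ n ih =>
      intro i j hij
      have hlt : (i : ℕ) + n < N := by have := j.2; omega
      exact (h ⟨i + n, hlt⟩ j (by simp; omega)).trans (ih i ⟨i + n, hlt⟩ rfl)
  intro i j hij
  have : (i : ℕ) ≤ j := hij
  exact key (j - i) i j (by omega)

theorem dE_bad {R : Type*} [CommRing R] (x : ℕ → ℤ → R) (s : ℤ) {N : ℕ} (M : ℕ)
    (Lam Mu : Fin N → ℤ) (hL : Antitone Lam) (hM : Antitone Mu) (S : Finset (Fin N))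
    (hS : ¬ goodS Lam Mu S) : dE x M (posZ s Mu) (posZ s (decS S Lam)) = 0 := by
  by_cases h1 : ∀ j, Mu j ≤ decS S Lam j
  · have h2 : ¬ Antitone (decS S Lam) := fun h => hS ⟨h, h1⟩
    have h3 : ∃ i j : Fin N, (j : ℕ) = i + 1 ∧ decS S Lam i < decS S Lam j := by
      by_contra hc
      push Not at hc
      exact h2 (fin_antitone_of_succ _ hc)
    obtain ⟨i, j, hij, hlt⟩ := h3
    have hle : i ≤ j := by rw [Fin.le_def]; omega
    have := hL hle
    refine dE_zero_of_eq _ _ _ _ i j (by intro h; rw [h] at hij; omega) ?_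
    simp only [posZ]
    simp only [decS] at hlt ⊢
    split_ifs at hlt ⊢ <;> omega
  · push Not at h1
    obtain ⟨j, hj⟩ := h1
    refine dE_zero_of_lt _ _ _ _ (posZ_anti _ _ hM) (posZ_decS_anti _ _ hL _) j ?_
    simp only [posZ]; omega

/-- Bottom cells of the columns in `S`. -/
def botD {N : ℕ} (Lam : Fin N → ℤ) (S : Finset (Fin N)) : Finset (ℕ × ℕ) :=
  S.image fun j => ((Lam j - 1).toNat, (j : ℕ))

theorem mem_botD {N : ℕ} (Lam : Fin N → ℤ) (S : Finset (Fin N)) (c : ℕ × ℕ) :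
    c ∈ botD Lam S ↔ ∃ j ∈ S, (Lam j - 1).toNat = c.1 ∧ (j : ℕ) = c.2 := by
  obtain ⟨c1, c2⟩ := c
  simp [botD]

theorem mem_botD' {N : ℕ} (Lam : Fin N → ℤ) (S : Finset (Fin N)) (i : ℕ) (j : Fin N) :
    (i, (j : ℕ)) ∈ botD Lam S ↔ j ∈ S ∧ (Lam j - 1).toNat = i := by
  rw [mem_botD]
  constructor
  · rintro ⟨k, h1, h2, h3⟩
    have : k = j := Fin.ext h3
    subst this
    exact ⟨h1, h2⟩
  · rintro ⟨h1, h2⟩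
    exact ⟨j, h1, h2, rfl⟩

theorem goodS_pos {N : ℕ} {Lam Mu : Fin N → ℤ} {S : Finset (Fin N)}
    (hS : goodS Lam Mu S) {j : Fin N} (hj : j ∈ S) : Mu j ≤ Lam j - 1 := by
  have := hS.2 j
  simpa [decS, hj] using this

theorem botD_sub {N : ℕ} {Lam Mu : Fin N → ℤ} (h0 : ∀ j, 0 ≤ Mu j) {S : Finset (Fin N)}
    (hS : goodS Lam Mu S) : botD Lam S ⊆ colC Lam Mu := by
  intro c hc
  rw [mem_botD] at hc
  obtain ⟨j, hj, h1, h2⟩ := hc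
  rw [mem_colC _ _ h0]
  have := goodS_pos hS hj
  have := h0 j
  exact ⟨j, by omega, by omega, h2.symm⟩

theorem botD_valid {N : ℕ} {Lam Mu : Fin N → ℤ} (hL : Antitone Lam) (h0 : ∀ j, 0 ≤ Mu j)
    {S : Finset (Fin N)} (hS : goodS Lam Mu S) : validC (colC Lam Mu) (botD Lam S) := by
  constructor
  · rintro ⟨c1, c2⟩ hc ⟨d1, d2⟩ hd h1 h2
    simp only at h1 h2
    subst h1
    rw [mem_botD] at hc
    obtain ⟨j, hj, e1, e2⟩ := hc
    rw [mem_colC _ _ h0] at hd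
    obtain ⟨k, e3, e4, e5⟩ := hd
    simp only at e1 e2 e3 e4 e5
    subst e5
    have hjk : j ≤ k := by rw [Fin.le_def]; omega
    have a1 := goodS_pos hS hj
    have a2 := h0 j
    have a3 := hL hjk
    have a4 := hS.1 hjk
    rw [mem_botD']
    refine ⟨?_, by omega⟩
    by_contra hk
    simp only [decS, hj, hk, if_true, if_false] at a4
    omega
  · rintro ⟨c1, c2⟩ hc ⟨d1, d2⟩ hd h1 h2
    simp only at h1 h2
    subst h2
    rw [mem_botD] at hc
    obtain ⟨j, hj, e1, e2⟩ := hc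
    simp only at e1 e2
    subst e2
    rw [mem_colC' _ _ h0] at hd
    have a1 := goodS_pos hS hj
    have a2 := h0 j
    omega

theorem sdiff_botD {N : ℕ} {Lam Mu : Fin N → ℤ} (h0 : ∀ j, 0 ≤ Mu j)
    {S : Finset (Fin N)} (hS : goodS Lam Mu S) :
    colC Lam Mu \ botD Lam S = colC (decS S Lam) Mu := by
  ext ⟨c1, c2⟩
  by_cases hc : c2 < N
  · obtain ⟨j, rfl⟩ : ∃ j : Fin N, c2 = j := ⟨⟨c2, hc⟩, rfl⟩
    rw [Finset.mem_sdiff, mem_colC' _ _ h0, mem_colC' _ _ h0, mem_botD']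
    have a2 := h0 j
    by_cases hj : j ∈ S
    · have a1 := goodS_pos hS hj
      simp only [decS, hj, if_true, true_and]
      omega
    · simp [decS, hj]
  · have hn : ∀ L : Fin N → ℤ, (c1, c2) ∉ colC L Mu := by
      intro L h
      rw [mem_colC _ _ h0] at h
      obtain ⟨j, -, -, h⟩ := h
      have := j.2
      simp only at h
      omega
    simp [hn]

/-- Columns touched by `D`. -/
def colsD (N : ℕ) (D : Finset (ℕ × ℕ)) : Finset (Fin N) :=
  Finset.univ.filter fun j => ∃ c ∈ D, c.2 = (j : ℕ)

theorem mem_colsD {N : ℕ} (D : Finset (ℕ × ℕ)) (j : Fin N) :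
    j ∈ colsD N D ↔ ∃ c ∈ D, c.2 = (j : ℕ) := by
  simp [colsD]

theorem colsD_botD {N : ℕ} (Lam : Fin N → ℤ) (S : Finset (Fin N)) : colsD N (botD Lam S) = S := by
  ext j
  rw [mem_colsD]
  constructor
  · rintro ⟨⟨c1, c2⟩, hc, rfl⟩
    rw [mem_botD'] at hc
    exact hc.1
  · intro h
    exact ⟨_, (mem_botD' Lam S _ j).2 ⟨h, rfl⟩, rfl⟩

theorem valid_bottom {N : ℕ} {Lam Mu : Fin N → ℤ} (h0 : ∀ j, 0 ≤ Mu j) {D : Finset (ℕ × ℕ)}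
    (hD : D ⊆ colC Lam Mu) (hv : validC (colC Lam Mu) D) {i : ℕ} {j : Fin N} (h : (i, (j : ℕ)) ∈ D) :
    Mu j ≤ i ∧ (i : ℤ) = Lam j - 1 := by
  have h1 := hD h
  rw [mem_colC' _ _ h0] at h1
  refine ⟨h1.1, ?_⟩
  by_contra hne
  refine hv.2 _ h (i + 1, (j : ℕ)) ?_ (by simp) rfl
  rw [mem_colC' _ _ h0]
  push_cast
  omega

theorem botD_colsD {N : ℕ} {Lam Mu : Fin N → ℤ} (h0 : ∀ j, 0 ≤ Mu j) {D : Finset (ℕ × ℕ)}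
    (hD : D ⊆ colC Lam Mu) (hv : validC (colC Lam Mu) D) : botD Lam (colsD N D) = D := by
  ext ⟨c1, c2⟩
  constructor
  · intro h
    rw [mem_botD] at h
    obtain ⟨j, hj, e1, e2⟩ := h
    simp only at e1 e2
    subst e2
    rw [mem_colsD] at hj
    obtain ⟨⟨d1, d2⟩, hd, rfl⟩ := hj
    have := valid_bottom h0 hD hv hd
    have e : c1 = d1 := by omega
    rw [e]; exact hd
  · intro h
    have h1 := hD h
    rw [mem_colC _ _ h0] at h1
    obtain ⟨j, -, -, e⟩ := h1
    simp only at e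
    subst e
    have := valid_bottom h0 hD hv h
    rw [mem_botD']
    exact ⟨(mem_colsD _ _).2 ⟨_, h, rfl⟩, by omega⟩

theorem colsD_good {N : ℕ} {Lam Mu : Fin N → ℤ} (hL : Antitone Lam) (hM : Antitone Mu)
    (h0 : ∀ j, 0 ≤ Mu j) (hle : ∀ j, Mu j ≤ Lam j) {D : Finset (ℕ × ℕ)}
    (hD : D ⊆ colC Lam Mu) (hv : validC (colC Lam Mu) D) : goodS Lam Mu (colsD N D) := by
  constructor
  · intro i j hij
    have a := hL hij
    have b := hM hij
    by_cases hi : i ∈ colsD N D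
    · by_cases hj : j ∈ colsD N D
      · simp only [decS, hi, hj, if_true]; omega
      · by_contra hc
        simp only [decS, hi, hj, if_true, if_false] at hc
        apply hj
        rw [mem_colsD] at hi ⊢
        obtain ⟨⟨d1, d2⟩, hd, rfl⟩ := hi
        have v := valid_bottom h0 hD hv hd
        refine ⟨(d1, (j : ℕ)), hv.1 _ hd _ ?_ rfl hij, rfl⟩
        rw [mem_colC' _ _ h0]
        omega
    · simp only [decS, hi, if_false]
      split_ifs <;> omega
  · intro j
    by_cases hj : j ∈ colsD N D
    · simp only [decS, hj, if_true]
      rw [mem_colsD] at hj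
      obtain ⟨⟨d1, d2⟩, hd, rfl⟩ := hj
      have v := valid_bottom h0 hD hv hd
      omega
    · simpa [decS, hj] using hle j

theorem tab_eq_dE {R : Type*} [CommRing R] (x : ℕ → ℤ → R) (f : ℕ → ℕ × ℕ → R) (s : ℤ)
    (hf : ∀ k (c : ℕ × ℕ), f k c = x k ((c.1 : ℤ) + 1 - c.2 - s)) {N : ℕ} (Mu : Fin N → ℤ)
    (hM : Antitone Mu) (h0 : ∀ j, 0 ≤ Mu j) (M : ℕ) :
    ∀ Lam : Fin N → ℤ, Antitone Lam → (∀ j, Mu j ≤ Lam j) →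
      tabC M (colC Lam Mu) f = dE x M (posZ s Mu) (posZ s Lam) := by
  classical
  induction M with
  | zero =>
    intro Lam hL hle
    rw [tabC_zero]
    split_ifs with h
    · have : Lam = Mu := by
        funext j
        by_contra hne
        have a1 := hle j
        have a2 := h0 j
        have : ((Mu j).toNat, (j : ℕ)) ∈ colC Lam Mu := by
          rw [mem_colC' _ _ h0]; omega
        rw [h] at this
        simp at this
      rw [this, dE_base_eq _ _ (posZ_strict s Mu hM).injective]
    · obtain ⟨c, hc⟩ := Finset.nonempty_iff_ne_empty.2 h
      rw [mem_colC _ _ h0] at hc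
      obtain ⟨j, h1, h2, -⟩ := hc
      rw [dE_base_ne _ _ _ (posZ_anti s Mu hM) (posZ_anti s Lam hL) j]
      simp only [posZ]; omega
  | succ M ih =>
    intro Lam hL hle
    rw [tabC_succ, dE_succ]
    rw [← Finset.sum_filter_add_sum_filter_not Finset.univ (fun S => goodS Lam Mu S)]
    have hz : ∑ S ∈ Finset.univ.filter (fun S => ¬ goodS Lam Mu S),
        (∏ j ∈ S, x (M + 1) (posZ s Lam j)) * dE x M (posZ s Mu) (decS S (posZ s Lam)) = 0 := by
      refine Finset.sum_eq_zero fun S hS => ?_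
      rw [decS_posZ, dE_bad x s M Lam Mu hL hM S (by simpa using hS), mul_zero]
    rw [hz, add_zero]
    symm
    refine Finset.sum_nbij' (botD Lam) (colsD N) ?_ ?_ ?_ ?_ ?_
    · intro S hS
      have hS' : goodS Lam Mu S := by simpa using hS
      simp only [Finset.mem_filter, Finset.mem_powerset]
      exact ⟨botD_sub h0 hS', botD_valid hL h0 hS'⟩
    · intro D hD
      simp only [Finset.mem_filter, Finset.mem_powerset] at hD
      simpa using colsD_good hL hM h0 hle hD.1 hD.2
    · intro S _
      exact colsD_botD Lam S
    · intro D hD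
      simp only [Finset.mem_filter, Finset.mem_powerset] at hD
      exact botD_colsD h0 hD.1 hD.2
    · intro S hS
      have hS' : goodS Lam Mu S := by simpa using hS
      rw [sdiff_botD h0 hS', ih _ hS'.1 hS'.2, decS_posZ]
      congr 1
      unfold botD
      rw [Finset.prod_image]
      · refine Finset.prod_congr rfl fun j hj => ?_
        rw [hf]
        congr 1
        have a1 := goodS_pos hS' hj
        have a2 := h0 j
        simp only [posZ]
        omega
      · intro i _ j _ hij
        exact Fin.ext (congrArg Prod.snd hij)

theorem lt_conjF {F : ℕ → ℕ} {B : ℕ} (hF : ∀ i j, i ≤ j → F j ≤ F i) (i j : ℕ) :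
    j < conjF F B i ↔ j < B ∧ i + 1 ≤ F j := by
  unfold conjF
  constructor
  · intro h
    by_contra hc
    have hs : ((Finset.range B).filter fun j => i + 1 ≤ F j) ⊆ Finset.range j := by
      intro k hk
      simp only [Finset.mem_filter, Finset.mem_range] at hk ⊢
      by_contra hjk
      have := hF j k (by omega)
      exact hc ⟨by omega, by omega⟩
    have := Finset.card_le_card hs
    rw [Finset.card_range] at this
    omega
  · rintro ⟨h1, h2⟩
    have hs : Finset.range (j + 1) ⊆ ((Finset.range B).filter fun j => i + 1 ≤ F j) := by
      intro k hk
      simp only [Finset.mem_filter, Finset.mem_range] at hk ⊢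
      have := hF k j (by omega)
      omega
    have := Finset.card_le_card hs
    rw [Finset.card_range] at this
    omega

theorem conjF_anti (F : ℕ → ℕ) (B : ℕ) (i j : ℕ) (h : i ≤ j) : conjF F B j ≤ conjF F B i := by
  unfold conjF
  refine Finset.card_le_card fun k hk => ?_
  simp only [Finset.mem_filter] at hk ⊢
  exact ⟨hk.1, by omega⟩

theorem tabSum_eq_tabC {R : Type*} [CommRing R] (M B : ℕ) (lam mu : ℕ → ℕ)
    (f : ℕ → ℕ × ℕ → R) : tabSum M B lam mu f = tabC M (cellsD B lam mu) f := rfl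

/-- Weights. -/
noncomputable def xW (a : ℤ → ℂ) : ℕ → ℤ → ℂ := fun k q => (k : ℂ) ^ (-(a (1 - q)))

theorem cellsD_eq_colC (B N : ℕ) (hNB : N ≤ B) (Lam Mu : ℕ → ℤ)
    (hL : ∀ i j, i ≤ j → Lam j ≤ Lam i) (hM : ∀ i j, i ≤ j → Mu j ≤ Mu i)
    (hL0 : ∀ i, N ≤ i → Lam i = 0) (hMn : ∀ i, 0 ≤ Mu i) :
    cellsD (Lam 0).toNat (conjF (fun i => (Lam i).toNat) B) (conjF (fun i => (Mu i).toNat) B) =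
      colC (fun j : Fin N => Lam j) (fun j : Fin N => Mu j) := by
  have hLn : ∀ i j, i ≤ j → (Lam j).toNat ≤ (Lam i).toNat := fun i j h => by
    have := hL i j h; omega
  have hMn' : ∀ i j, i ≤ j → (Mu j).toNat ≤ (Mu i).toNat := fun i j h => by
    have := hM i j h; omega
  ext ⟨i, j⟩
  rw [mem_colC _ _ (fun j => hMn j)]
  simp only [cellsD, Finset.mem_filter, Finset.mem_product, Finset.mem_range]
  have e1 := lt_conjF (B := B) hLn i j
  have e2 := lt_conjF (B := B) hMn' i j
  have e3 := conjF_anti (fun i => (Lam i).toNat) B 0 i (Nat.zero_le _)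
  have m := hMn j
  have l0 := hL 0 j (Nat.zero_le _)
  constructor
  · rintro ⟨-, h1, h2⟩
    have h3 := e1.1 h2
    have h4 : ¬ (j < B ∧ i + 1 ≤ (Mu j).toNat) := fun h => absurd (e2.2 h) (by omega)
    have h5 : j < N := by
      by_contra hc
      have := hL0 j (by omega)
      omega
    exact ⟨⟨j, h5⟩, by simp only; omega, by simp only; omega, rfl⟩
  · rintro ⟨k, h1, h2, h3⟩
    subst h3
    have hk := k.2
    have h3 := e1.2 ⟨by omega, by omega⟩
    have h4 : ¬ ((k : ℕ) < conjF (fun i => (Mu i).toNat) B i) := fun h => by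
      have := e2.1 h
      omega
    exact ⟨⟨by omega, by omega⟩, by omega, h3⟩

theorem zetaZConj_eq (M B N : ℕ) (hNB : N ≤ B) (Lam Mu : ℕ → ℤ) (s : ℤ) (a a' : ℤ → ℂ)
    (ha : ∀ c, a' c = a (c + s))
    (hL : ∀ i j, i ≤ j → j < N → Lam j ≤ Lam i) (hM : ∀ i j, i ≤ j → j < N → Mu j ≤ Mu i)
    (hL0 : ∀ i, N ≤ i → Lam i = 0) (hM0 : ∀ i, N ≤ i → Mu i = 0) (hMn : ∀ i, 0 ≤ Mu i) :
    zetaZConj M B Lam Mu a' =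
      dE (xW a) M (posZ s (fun j : Fin N => Mu j)) (posZ s (fun j : Fin N => Lam j)) := by
  have hLa : Antitone (fun j : Fin N => Lam j) := fun i j h => hL i j h j.2
  have hMa : Antitone (fun j : Fin N => Mu j) := fun i j h => hM i j h j.2
  unfold zetaZConj
  by_cases hle : ∀ j : Fin N, Mu j ≤ Lam j
  · have hle' : ∀ j, Mu j ≤ Lam j := by
      intro j
      by_cases hj : j < N
      · exact hle ⟨j, hj⟩
      · rw [hL0 j (by omega), hM0 j (by omega)]
    have hL' : ∀ i j, i ≤ j → Lam j ≤ Lam i := by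
      intro i j h
      by_cases hj : j < N
      · exact hL i j h hj
      · rw [hL0 j (by omega)]; exact (hMn i).trans (hle' i)
    have hM' : ∀ i j, i ≤ j → Mu j ≤ Mu i := by
      intro i j h
      by_cases hj : j < N
      · exact hM i j h hj
      · rw [hM0 j (by omega)]; exact hMn i
    rw [if_pos]
    · unfold zetaT zetaTF
      rw [tabSum_eq_tabC, cellsD_eq_colC B N hNB Lam Mu hL' hM' hL0 hMn]
      refine tab_eq_dE (xW a) _ s ?_ _ hMa (fun j => hMn j) M _ hLa hle
      intro k c
      simp only [xW, ha]
      congr 3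
      ring
    · exact ⟨⟨fun i => hL' _ _ (Nat.le_succ i), fun i => (hMn i).trans (hle' i),
        fun i hi => hL0 i (by omega)⟩, ⟨fun i => hM' _ _ (Nat.le_succ i), hMn,
        fun i hi => hM0 i (by omega)⟩, hle'⟩
  · rw [if_neg]
    · push Not at hle
      obtain ⟨j, hj⟩ := hle
      rw [dE_zero_of_lt _ _ _ _ (posZ_anti _ _ hMa) (posZ_anti _ _ hLa) j]
      simp only [posZ]; omega
    · intro h
      exact hle fun j => h.2.2 j

theorem dE_eq_sub {R : Type*} [CommRing R] (x : ℕ → ℤ → R) {N K : ℕ} (M : ℕ) (p q : Fin K → ℤ)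
    (u v : Fin N → Fin K) (p' q' : Fin N → ℤ) (hp : ∀ i, p' i = p (u i)) (hq : ∀ i, q' i = q (v i)) :
    dE x M p' q' = ((Matrix.of fun i j : Fin K => eP x M (p i) (q j)).submatrix u v).det := by
  unfold dE
  congr 1
  ext i j
  simp [hp, hq]

/-- Desnanot–Jacobi relation for truncated Schur multiple zeta values, column version. -/
theorem desnanot_jacobi_zeta_col (M : ℕ) (hM : 0 < M) (a : ℤ → ℂ)
    (l : ℕ) (hl : 1 ≤ l)
    (L : ℕ) (lam mu : ℕ → ℕ)
    (hlam : ∀ i, lam (i + 1) ≤ lam i) (hmu : ∀ i, mu (i + 1) ≤ mu i)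
    (hsub : ∀ i, mu i ≤ lam i)
    (hlen : ∀ i, L ≤ i → lam i = 0)
    (hconjlen : lam 0 ≤ l + 1) :
    zetaZConj M (l + 1) (fun i => if i < l + 1 then (conjF lam L i : ℤ) else 0)
        (fun i => if i < l + 1 then (conjF mu L i : ℤ) else 0) a *
      zetaZConj M (l + 1) (fun i => if i < l - 1 then (conjF lam L (i + 1) : ℤ) else 0)
        (fun i => if i < l - 1 then (conjF mu L (i + 1) : ℤ) else 0) (fun c => a (c + 1)) =
    zetaZConj M (l + 1) (fun i => if i < l then (conjF lam L i : ℤ) else 0)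
        (fun i => if i < l then (conjF mu L i : ℤ) else 0) a *
      zetaZConj M (l + 1) (fun i => if i < l then (conjF lam L (i + 1) : ℤ) else 0)
        (fun i => if i < l then (conjF mu L (i + 1) : ℤ) else 0) (fun c => a (c + 1)) -
    zetaZConj M (l + 1) (fun i => if i < l then (conjF lam L (i + 1) : ℤ) - 1 else 0)
        (fun i => if i < l then (conjF mu L i : ℤ) else 0) a *
      zetaZConj M (l + 1) (fun i => if i < l then (conjF lam L i : ℤ) + 1 else 0)
        (fun i => if i < l then (conjF mu L (i + 1) : ℤ) else 0) (fun c => a (c + 1)) := by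
  have cl := conjF_anti lam L
  have cm := conjF_anti mu L
  obtain ⟨m, rfl⟩ : ∃ m, l = m + 1 := ⟨l - 1, by omega⟩
  have hm : m + 1 - 1 = m := rfl
  rw [hm]
  generalize conjF lam L = P at cl ⊢
  generalize conjF mu L = Q at cm ⊢
  rw [zetaZConj_eq M (m+1+1) (m+2) le_rfl _ _ 0 a a (by simp),
    zetaZConj_eq M (m+1+1) m (by omega) _ _ 1 a _ (fun _ => rfl),
    zetaZConj_eq M (m+1+1) (m+1) (by omega) _ _ 0 a a (by simp),
    zetaZConj_eq M (m+1+1) (m+1) (by omega) _ _ 1 a _ (fun _ => rfl),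
    zetaZConj_eq M (m+1+1) (m+1) (by omega) _ _ 0 a a (by simp),
    zetaZConj_eq M (m+1+1) (m+1) (by omega) _ _ 1 a _ (fun _ => rfl)]
  · have dj := desnanot_jacobi (Matrix.of fun i j : Fin (m+2) =>
      eP (xW a) M ((Q i : ℤ) - (i : ℕ)) ((P j : ℤ) - (j : ℕ)))
    rw [← submatrix_id_id (Matrix.of fun i j : Fin (m+2) =>
      eP (xW a) M ((Q i : ℤ) - (i : ℕ)) ((P j : ℤ) - (j : ℕ)))] at dj
    simp only [submatrix_submatrix, Function.id_comp] at dj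
    rw [← dE_eq_sub (xW a) M (fun i : Fin (m+2) => (Q i : ℤ) - (i : ℕ)) (fun j : Fin (m+2) => (P j : ℤ) - (j : ℕ))
        id id (posZ 0 _) (posZ 0 _) ?_ ?_,
      ← dE_eq_sub (xW a) M (fun i : Fin (m+2) => (Q i : ℤ) - (i : ℕ)) (fun j : Fin (m+2) => (P j : ℤ) - (j : ℕ))
        (fun i : Fin m => i.succ.castSucc) (fun i : Fin m => i.succ.castSucc) (posZ 1 _) (posZ 1 _) ?_ ?_,
      ← dE_eq_sub (xW a) M (fun i : Fin (m+2) => (Q i : ℤ) - (i : ℕ)) (fun j : Fin (m+2) => (P j : ℤ) - (j : ℕ))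
        Fin.castSucc Fin.castSucc (posZ 0 _) (posZ 0 _) ?_ ?_,
      ← dE_eq_sub (xW a) M (fun i : Fin (m+2) => (Q i : ℤ) - (i : ℕ)) (fun j : Fin (m+2) => (P j : ℤ) - (j : ℕ))
        Fin.succ Fin.succ (posZ 1 _) (posZ 1 _) ?_ ?_,
      ← dE_eq_sub (xW a) M (fun i : Fin (m+2) => (Q i : ℤ) - (i : ℕ)) (fun j : Fin (m+2) => (P j : ℤ) - (j : ℕ))
        Fin.castSucc Fin.succ (posZ 0 _) (posZ 0 _) ?_ ?_,
      ← dE_eq_sub (xW a) M (fun i : Fin (m+2) => (Q i : ℤ) - (i : ℕ)) (fun j : Fin (m+2) => (P j : ℤ) - (j : ℕ))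
        Fin.succ Fin.castSucc (posZ 1 _) (posZ 1 _) ?_ ?_] at dj
    · exact dj
    all_goals
      intro i
      have hi := i.2
      simp only [posZ, id, Fin.val_castSucc, Fin.val_succ]
      first | rw [if_pos hi] | skip
      push_cast
      ring
  all_goals first
    | (intro i j hij hj
       rw [if_pos hj, if_pos (by omega)]
       have h1 := cl i j hij
       have h2 := cm i j hij
       have h3 := cl (i+1) (j+1) (by omega)
       have h4 := cm (i+1) (j+1) (by omega)
       omega)
    | (intro i hi
       rw [if_neg (by omega)])
    | (intro i
       split_ifs <;> omega)
end

section
/- Plücker-type relation for truncated Schur multiple zeta values (Corollary 5.4(1)): Let M be a positive integer and a : ℤ → ℂ. Let λ be a partition with n corners, written λ = (m_1^{r_1} m_2^{r_2−r_1} ⋯ m_n^{r_n−r_{n−1}}) with m_1 > ⋯ > m_n > 0 and 0 < r_1 < ⋯ < r_n. Fix 1 ≤ d ≤ n and set ℓ := r_d. Then ζ^M_{λ}(a) · ζ^M_{λ}(τ^{−1}a) = ζ^M_{λ−(1^ℓ)}(a) · ζ^M_{λ+(1^ℓ)}(τ^{−1}a) + Σ_{t=1}^{min(d, n−d+1)}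 (−1)^{t−1} Σ_{1 ≤ p_1 < ⋯ < p_t ≤ d, d ≤ q_t < ⋯ < q_1 ≤ n} ζ^M_{add^{p_1,…,p_t}_{q_1,…,q_t}(λ)}(a) · ζ^M_{rem^{p_1,…,p_t}_{q_1,…,q_t}(λ)}(τ^{−1}a). -/
open Matrix BigOperators Finset Filter

/-! ### Part A: tableau sums as determinants -/

/-- Path-generating entries: `VVm g m s t` is the weighted count of paths from `t` to `s`
using levels `1,…,m`. -/
noncomputable def VVm (g : ℕ → ℕ → ℂ) : ℕ → ℕ → ℕ → ℂ
  | 0, s, t => if s = t then 1 else 0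
  | m + 1, 0, t => VVm g m 0 t
  | m + 1, s + 1, t => g (m + 1) s * VVm g (m + 1) s t + VVm g m (s + 1) t

/-- The flagged determinant. -/
noncomputable def flagDet (g : ℕ → ℕ → ℂ) (r : ℕ) (x b : ℕ → ℕ) : ℂ :=
  Matrix.det (Matrix.of fun j i : Fin r => VVm g (b j) (x j) (r - 1 - (i : ℕ)))

open Classical in
/-- The flagged tableau sum. -/
noncomputable def flagSum (M B : ℕ) (lam : ℕ → ℕ) (b : ℕ → ℕ) (w : ℕ → ℤ → ℂ) : ℂ :=
  ∑ T ∈ Finset.univ.filter (fun T : ↥(cellsD B lam (fun _ => 0)) → Fin M =>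
      IsSSYT T ∧ ∀ c, (T c : ℕ) < b c.val.1),
    ∏ c : ↥(cellsD B lam (fun _ => 0)), w ((T c : ℕ) + 1) ((c.val.2 : ℤ) - (c.val.1 : ℤ))

lemma mem_cellsD_iff {B : ℕ} {lam : ℕ → ℕ} (hl : Antitone lam) (c : ℕ × ℕ) :
    c ∈ cellsD B lam (fun _ => 0) ↔ c.1 < B ∧ c.2 < lam c.1 := by
  have := hl (Nat.zero_le c.1)
  simp only [cellsD, Finset.mem_filter, Finset.mem_product, Finset.mem_range]
  constructor
  · rintro ⟨⟨h1, h2⟩, h3, h4⟩; exact ⟨h1, h4⟩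
  · rintro ⟨h1, h2⟩; exact ⟨⟨h1, by omega⟩, by omega, h2⟩

/-- positions -/
def xpos (r : ℕ) (lam : ℕ → ℕ) : ℕ → ℕ := fun j => lam j + (r - 1 - j)

/-- the flags `m` on the first `k` rows and `m+1` afterwards -/
def flg (m k : ℕ) : ℕ → ℕ := fun i => if i < k then m else m + 1

lemma flagSum_congr (M B : ℕ) {lam : ℕ → ℕ} (hl : Antitone lam) (b b' : ℕ → ℕ) (w : ℕ → ℤ → ℂ)
    (h : ∀ i, 0 < lam i → b i = b' i) : flagSum M B lam b w = flagSum M B lam b' w := by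
  unfold flagSum
  congr 1
  ext T
  simp only [Finset.mem_filter, Finset.mem_univ, true_and]
  refine and_congr Iff.rfl (forall_congr' fun c => ?_)
  rw [h]
  have := (mem_cellsD_iff hl _).1 c.2
  omega

lemma flagDet_congr (g : ℕ → ℕ → ℂ) (r : ℕ) (x b b' : ℕ → ℕ) (h : ∀ i < r, b i = b' i) :
    flagDet g r x b = flagDet g r x b' := by
  unfold flagDet
  congr 1
  ext j i
  simp [h j j.2]

lemma flag_base (M B r : ℕ) (hB : r ≤ B) (g : ℕ → ℕ → ℂ) (w : ℕ → ℤ → ℂ) (lam : ℕ → ℕ)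
    (hl : Antitone lam) (hr : ∀ i, r ≤ i → lam i = 0) :
    flagSum M B lam (fun _ => 0) w = flagDet g r (xpos r lam) (fun _ => 0) := by
  by_cases h0 : lam 0 = 0
  · have hz : ∀ i, lam i = 0 := fun i => by have := hl (Nat.zero_le i); omega
    have hE : IsEmpty ↥(cellsD B lam (fun _ => 0)) := by
      constructor
      rintro ⟨c, hc⟩
      have := (mem_cellsD_iff hl c).1 hc
      rw [hz] at this; omega
    have h1 : flagDet g r (xpos r lam) (fun _ => 0) = 1 := by
      unfold flagDet
      rw [← Matrix.det_one (n := Fin r)]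
      congr 1
      ext j i
      simp only [Matrix.of_apply, VVm, xpos, hz, Matrix.one_apply]
      congr 1
      rw [eq_iff_iff, Fin.ext_iff]
      have := j.2; have := i.2; omega
    rw [h1]
    unfold flagSum
    rw [Finset.sum_filter, Finset.sum_congr rfl (g := fun _ => (1 : ℂ))]
    · simp
    · intro T _
      rw [if_pos]
      · simp
      exact ⟨⟨fun c => (hE.false c).elim, fun c => (hE.false c).elim⟩, fun c => (hE.false c).elim⟩
  · have hrpos : 0 < r := by
      by_contra hh
      exact h0 (hr 0 (by omega))
    have h1 : flagDet g r (xpos r lam) (fun _ => 0) = 0 := by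
      unfold flagDet
      apply Matrix.det_eq_zero_of_row_eq_zero (⟨0, hrpos⟩ : Fin r)
      intro i
      simp only [Matrix.of_apply, VVm, xpos]
      rw [if_neg]
      omega
    rw [h1]
    unfold flagSum
    apply Finset.sum_eq_zero
    intro T hT
    simp only [Finset.mem_filter] at hT
    have := hT.2.2 ⟨(0,0), (mem_cellsD_iff hl _).2 ⟨by dsimp; omega, by dsimp; omega⟩⟩
    omega

lemma VVm_pos (g : ℕ → ℕ → ℂ) (m s t : ℕ) (hs : 0 < s) :
    VVm g (m + 1) s t = g (m + 1) (s - 1) * VVm g (m + 1) (s - 1) t + VVm g m s t := by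
  obtain ⟨s, rfl⟩ : ∃ s', s = s' + 1 := ⟨s - 1, by omega⟩
  simp [VVm]

/-- determinant recurrence -/
lemma flagDet_step (g : ℕ → ℕ → ℂ) (r : ℕ) (x : ℕ → ℕ) (m k : ℕ) (hk : k < r) (hx : 0 < x k) :
    flagDet g r x (flg m k) = g (m + 1) (x k - 1) *
        flagDet g r (Function.update x k (x k - 1)) (flg m k) + flagDet g r x (flg m (k + 1)) := by
  unfold flagDet
  set A : Matrix (Fin r) (Fin r) ℂ :=
    Matrix.of fun j i : Fin r => VVm g (flg m k j) (x j) (r - 1 - (i : ℕ)) with hA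
  have e1 : A = A.updateRow ⟨k, hk⟩ (g (m + 1) (x k - 1) •
      (fun i : Fin r => VVm g (m + 1) (x k - 1) (r - 1 - (i : ℕ))) +
      (fun i : Fin r => VVm g m (x k) (r - 1 - (i : ℕ)))) := by
    ext j i
    by_cases hj : j = ⟨k, hk⟩
    · subst hj
      simp only [Matrix.updateRow_self, hA, Matrix.of_apply, flg, lt_irrefl, if_false,
        Pi.add_apply, Pi.smul_apply, smul_eq_mul]
      exact VVm_pos g m _ _ hx
    · rw [Matrix.updateRow_ne hj]
  rw [e1, Matrix.det_updateRow_add, Matrix.det_updateRow_smul]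
  congr 3
  · ext j i
    by_cases hj : j = ⟨k, hk⟩
    · subst hj
      simp [flg]
    · have hj' : (j : ℕ) ≠ k := fun h => hj (Fin.ext h)
      rw [Matrix.updateRow_ne hj]
      simp [hA, Function.update_of_ne hj']
  · ext j i
    by_cases hj : j = ⟨k, hk⟩
    · subst hj
      simp [flg]
    · have hj' : (j : ℕ) ≠ k := fun h => hj (Fin.ext h)
      rw [Matrix.updateRow_ne hj]
      have : flg m k j = flg m (k + 1) j := by
        unfold flg; split_ifs <;> omega
      simp [hA, this]

lemma flagDet_step_zero (g : ℕ → ℕ → ℂ) (r : ℕ) (x : ℕ → ℕ) (m k : ℕ) (hx : x k = 0) :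
    flagDet g r x (flg m k) = flagDet g r x (flg m (k + 1)) := by
  unfold flagDet
  congr 1
  ext j i
  simp only [Matrix.of_apply]
  by_cases hj : (j : ℕ) = k
  · rw [hj, hx]; simp [flg, VVm]
  · have : flg m k j = flg m (k + 1) j := by
      unfold flg; split_ifs <;> omega
    rw [this]

/-- equal rows case -/
lemma flagDet_step_eq (g : ℕ → ℕ → ℂ) (r : ℕ) (x : ℕ → ℕ) (m k : ℕ) (hk : k + 1 < r)
    (hx : x k = x (k + 1) + 1) :
    flagDet g r x (flg m k) = flagDet g r x (flg m (k + 1)) := by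
  rw [flagDet_step g r x m k (by omega) (by omega)]
  have : flagDet g r (Function.update x k (x k - 1)) (flg m k) = 0 := by
    unfold flagDet
    apply Matrix.det_zero_of_row_eq (i := (⟨k, by omega⟩ : Fin r)) (j := ⟨k + 1, hk⟩)
    · simp
    · ext i
      simp [flg, hx]
  rw [this]; ring

lemma flagSum_step_eq (M B : ℕ) {lam : ℕ → ℕ} (hl : Antitone lam) (w : ℕ → ℤ → ℂ) (m k : ℕ)
    (h : lam k = lam (k + 1)) (hB : 0 < lam k → k + 1 < B) :
    flagSum M B lam (flg m k) w = flagSum M B lam (flg m (k + 1)) w := by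
  unfold flagSum
  congr 1
  ext T
  simp only [Finset.mem_filter, Finset.mem_univ, true_and]
  refine and_congr_right fun hT => ⟨fun hb c => ?_, fun hb c => ?_⟩
  · have hc := (mem_cellsD_iff hl _).1 c.2
    have hbc := hb c
    by_cases hk : c.val.1 = k
    · rw [hk] at hc
      have hmem : (k + 1, c.val.2) ∈ cellsD B lam (fun _ => 0) :=
        (mem_cellsD_iff hl _).2 ⟨hB (by omega), by dsimp; omega⟩
      have h1 := hT.2 c ⟨_, hmem⟩ (by simp [hk]) rfl
      have h2 := hb ⟨_, hmem⟩
      simp only [flg] at h2 ⊢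
      rw [hk, if_pos (by omega)]
      rw [if_neg (by omega)] at h2
      have : (T c : ℕ) < T ⟨_, hmem⟩ := h1
      omega
    · unfold flg at hbc ⊢; split_ifs at hbc ⊢ <;> omega
  · have hbc := hb c
    unfold flg at hbc ⊢; split_ifs at hbc ⊢ <;> omega

lemma update_antitone {lam : ℕ → ℕ} (hl : Antitone lam) (k : ℕ) (h : lam (k + 1) < lam k) :
    Antitone (Function.update lam k (lam k - 1)) := by
  apply antitone_nat_of_succ_le
  intro i
  have := hl (Nat.le_succ i)
  simp only [Function.update_apply]
  split_ifs with h1 h2 h2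
  · omega
  · subst h1; simp only [Nat.succ_eq_add_one] at this; omega
  · subst h2; omega
  · exact this

/-- tableau recurrence -/
lemma flagSum_step (M B : ℕ) {lam : ℕ → ℕ} (hl : Antitone lam) (w : ℕ → ℤ → ℂ) (m k : ℕ)
    (h : lam (k + 1) < lam k) (hB : k < B) (hm : m + 1 ≤ M) :
    flagSum M B lam (flg m k) w = w (m + 1) ((lam k : ℤ) - 1 - k) *
        flagSum M B (Function.update lam k (lam k - 1)) (flg m k) w
        + flagSum M B lam (flg m (k + 1)) w := by
  classical
  have hl' := update_antitone hl k h
  set lam' := Function.update lam k (lam k - 1) with hlam'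
  have hmem : ∀ c, c ∈ cellsD B lam (fun _ => 0) ↔ c.1 < B ∧ c.2 < lam c.1 := mem_cellsD_iff hl
  have hmem' : ∀ c, c ∈ cellsD B lam' (fun _ => 0) ↔ c.1 < B ∧ c.2 < lam' c.1 :=
    mem_cellsD_iff hl'
  have hlk : lam' k = lam k - 1 := by simp [hlam']
  have hlne : ∀ i, i ≠ k → lam' i = lam i := fun i hi => by simp [hlam', hi]
  obtain ⟨c0, hc1, hc2⟩ : ∃ c0 : ℕ × ℕ, c0.1 = k ∧ c0.2 = lam k - 1 := ⟨(k, lam k - 1), rfl, rfl⟩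
  have hc0mem : c0 ∈ cellsD B lam (fun _ => 0) := (hmem _).2 ⟨by omega, by rw [hc1]; omega⟩
  have hc0not : c0 ∉ cellsD B lam' (fun _ => 0) := by
    rw [hmem']; simp [hc1, hc2, hlk]
  have hins : cellsD B lam (fun _ => 0) = insert c0 (cellsD B lam' (fun _ => 0)) := by
    ext c
    rw [Finset.mem_insert, hmem, hmem']
    by_cases hk : c.1 = k
    · rw [hk, hlk, Prod.ext_iff, hk, hc1, hc2]; omega
    · rw [hlne _ hk, Prod.ext_iff]; simp [hk, hc1]
  have hsub : ∀ c, c ∈ cellsD B lam' (fun _ => 0) → c ∈ cellsD B lam (fun _ => 0) := by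
    intro c hc; rw [hins]; exact Finset.mem_insert_of_mem hc
  have hor : ∀ c, c ∈ cellsD B lam (fun _ => 0) → c ∉ cellsD B lam' (fun _ => 0) → c = c0 := by
    intro c hc hn; rw [hins, Finset.mem_insert] at hc; tauto
  -- split
  have hsplit : flagSum M B lam (flg m k) w =
      (∑ T ∈ Finset.univ.filter (fun T : ↥(cellsD B lam (fun _ => 0)) → Fin M =>
        (IsSSYT T ∧ ∀ c, (T c : ℕ) < flg m k c.val.1) ∧ (T ⟨c0, hc0mem⟩ : ℕ) = m),
        ∏ c : ↥(cellsD B lam (fun _ => 0)), w ((T c : ℕ) + 1) ((c.val.2 : ℤ) - (c.val.1 : ℤ))) +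
      flagSum M B lam (flg m (k + 1)) w := by
    unfold flagSum
    rw [← Finset.sum_filter_add_sum_filter_not _ (fun T => (T ⟨c0, hc0mem⟩ : ℕ) = m)]
    congr 1
    · rw [Finset.filter_filter]
    · rw [Finset.filter_filter]
      congr 1
      ext T
      simp only [Finset.mem_filter, Finset.mem_univ, true_and]
      constructor
      · rintro ⟨⟨hT, hb⟩, hne⟩
        refine ⟨hT, fun c => ?_⟩
        have hbc := hb c
        by_cases hk : c.val.1 = k
        · have hc := (hmem _).1 c.2
          have h1 := hT.1 c ⟨c0, hc0mem⟩ (by simp [hc1, hk]) (by simp only [hc2]; rw [hk] at hc; omega)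
          have h2 := hb ⟨c0, hc0mem⟩
          have h1' : (T c : ℕ) ≤ T ⟨c0, hc0mem⟩ := h1
          simp only [hc1, flg, lt_irrefl, if_false] at h2
          simp only [flg, hk]
          rw [if_pos (by omega)]
          omega
        · unfold flg at hbc ⊢; split_ifs at hbc ⊢ <;> omega
      · rintro ⟨hT, hb⟩
        refine ⟨⟨hT, fun c => ?_⟩, ?_⟩
        · have hbc := hb c
          unfold flg at hbc ⊢; split_ifs at hbc ⊢ <;> omega
        · have hbc := hb ⟨c0, hc0mem⟩
          simp only [hc1, flg] at hbc
          rw [if_pos (by omega)] at hbc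
          omega
  rw [hsplit]
  congr 1
  unfold flagSum
  rw [Finset.mul_sum]
  refine Finset.sum_bij' (fun T _ => fun c : ↥(cellsD B lam' (fun _ => 0)) =>
      T ⟨c.1, hsub c.1 c.2⟩)
    (fun T' _ => fun c : ↥(cellsD B lam (fun _ => 0)) =>
      if hc : c.1 ∈ cellsD B lam' (fun _ => 0) then T' ⟨c.1, hc⟩ else ⟨m, by omega⟩) ?_ ?_ ?_ ?_ ?_
  · intro T hT
    simp only [Finset.mem_filter, Finset.mem_univ, true_and] at hT ⊢
    obtain ⟨⟨⟨h1, h2⟩, h3⟩, h4⟩ := hT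
    exact ⟨⟨fun c c' e1 e2 => h1 _ _ e1 e2, fun c c' e1 e2 => h2 _ _ e1 e2⟩, fun c => h3 _⟩
  · intro T' hT
    simp only [Finset.mem_filter, Finset.mem_univ, true_and] at hT ⊢
    obtain ⟨⟨h1, h2⟩, h3⟩ := hT
    refine ⟨⟨⟨?_, ?_⟩, ?_⟩, ?_⟩
    · intro c c' e1 e2
      beta_reduce
      by_cases hc : c.1 ∈ cellsD B lam' (fun _ => 0)
      · by_cases hc' : c'.1 ∈ cellsD B lam' (fun _ => 0)
        · rw [dif_pos hc, dif_pos hc']; exact h1 _ _ e1 e2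
        · rw [dif_pos hc, dif_neg hc']
          have hcc := hor _ c'.2 hc'
          have := h3 ⟨c.1, hc⟩
          rw [hcc] at e1
          simp only [e1, hc1, flg, lt_irrefl, if_false] at this
          rw [Fin.le_def]; dsimp only; omega
      · have hcc := hor _ c.2 hc
        have hc3 := (hmem _).1 c'.2
        have : c'.1 = c0 := by
          rw [hcc] at e1 e2
          rw [← e1, hc1] at hc3
          rw [hc2] at e2
          apply Prod.ext
          · exact e1.symm
          · omega
        rw [dif_neg hc, dif_neg (by rw [this]; exact hc0not)]
    · intro c c' e1 e2
      beta_reduce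
      have hc : c.1 ∈ cellsD B lam' (fun _ => 0) := by
        by_contra hc
        have hcc := hor _ c.2 hc
        have hc3 := (hmem _).1 c'.2
        rw [hcc] at e1 e2
        rw [hc1] at e1
        rw [hc2] at e2
        have := hl (show k + 1 ≤ c'.1.1 by omega)
        omega
      by_cases hc' : c'.1 ∈ cellsD B lam' (fun _ => 0)
      · rw [dif_pos hc, dif_pos hc']; exact h2 _ _ e1 e2
      · rw [dif_pos hc, dif_neg hc']
        have hcc := hor _ c'.2 hc'
        have := h3 ⟨c.1, hc⟩
        rw [hcc] at e1
        rw [hc1] at e1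
        simp only [flg] at this
        rw [if_pos e1] at this
        rw [Fin.lt_def]; exact this
    · intro c
      by_cases hc : c.1 ∈ cellsD B lam' (fun _ => 0)
      · rw [dif_pos hc]; exact h3 _
      · rw [dif_neg hc, hor _ c.2 hc]
        simp [flg, hc1]
    · rw [dif_neg hc0not]
  · intro T hT
    simp only [Finset.mem_filter, Finset.mem_univ, true_and] at hT
    funext c
    dsimp only
    split_ifs with hc
    · rfl
    · have hcc := hor _ c.2 hc
      have : c = ⟨c0, hc0mem⟩ := Subtype.ext hcc
      rw [this]
      exact Fin.ext hT.2.symm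
  · intro T' hT
    funext c
    dsimp only
    rw [dif_pos c.2]
  · intro T hT
    simp only [Finset.mem_filter, Finset.mem_univ, true_and] at hT
    set F : ℕ × ℕ → ℂ := fun c => if hc : c ∈ cellsD B lam (fun _ => 0) then
      w ((T ⟨c, hc⟩ : ℕ) + 1) ((c.2 : ℤ) - (c.1 : ℤ)) else 1 with hF
    have e1 : ∏ c : ↥(cellsD B lam (fun _ => 0)),
        w ((T c : ℕ) + 1) ((c.val.2 : ℤ) - (c.val.1 : ℤ)) =
        ∏ c ∈ cellsD B lam (fun _ => 0), F c := by
      rw [← Finset.prod_coe_sort _ F]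
      refine Finset.prod_congr rfl fun c _ => ?_
      simp only [hF]
      rw [dif_pos c.2]
    have e2 : ∏ c : ↥(cellsD B lam' (fun _ => 0)),
        w ((T ⟨c.1, hsub c.1 c.2⟩ : ℕ) + 1) ((c.val.2 : ℤ) - (c.val.1 : ℤ)) =
        ∏ c ∈ cellsD B lam' (fun _ => 0), F c := by
      rw [← Finset.prod_coe_sort _ F]
      refine Finset.prod_congr rfl fun c _ => ?_
      simp only [hF]
      rw [dif_pos (hsub c.1 c.2)]
    rw [e1, e2, hins, Finset.prod_insert hc0not]
    congr 1
    simp only [hF]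
    rw [dif_pos hc0mem, hT.2]
    congr 1
    rw [hc1, hc2]
    omega

lemma xpos_update (r : ℕ) (lam : ℕ → ℕ) (k : ℕ) (h : 0 < lam k) :
    xpos r (Function.update lam k (lam k - 1)) =
      Function.update (xpos r lam) k (xpos r lam k - 1) := by
  funext j
  by_cases hj : j = k
  · subst hj; simp [xpos]; omega
  · simp [xpos, hj]

theorem flag_main (M B r : ℕ) (hB : r ≤ B) (g : ℕ → ℕ → ℂ) (w : ℕ → ℤ → ℂ)
    (hg : ∀ k s, g k s = w k ((s : ℤ) + 1 - r)) :
    ∀ m, m ≤ M → ∀ lam : ℕ → ℕ, Antitone lam → (∀ i, r ≤ i → lam i = 0) →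
    flagSum M B lam (fun _ => m) w = flagDet g r (xpos r lam) (fun _ => m) := by
  intro m
  induction m with
  | zero => intro _ lam hl hr; exact flag_base M B r hB g w lam hl hr
  | succ m ih =>
    intro hm
    have key : ∀ j, j ≤ r → ∀ lam : ℕ → ℕ, Antitone lam → (∀ i, r ≤ i → lam i = 0) →
        flagSum M B lam (flg m (r - j)) w = flagDet g r (xpos r lam) (flg m (r - j)) := by
      intro j
      induction j with
      | zero =>
        intro _ lam hl hr
        rw [flagSum_congr M B hl _ (fun _ => m), flagDet_congr g r _ _ (fun _ => m)]
        · exact ih (by omega) lam hl hr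
        · intro i hi; simp [flg, hi]
        · intro i hi
          have : i < r := by by_contra hh; have := hr i (by omega); omega
          simp [flg, this]
      | succ j ihj =>
        intro hj
        obtain ⟨k, hk⟩ : ∃ k, k = r - (j + 1) := ⟨_, rfl⟩
        have hk1 : r - j = k + 1 := by omega
        rw [← hk]
        rw [hk1] at ihj
        have inner : ∀ v, ∀ lam : ℕ → ℕ, lam k = v → Antitone lam → (∀ i, r ≤ i → lam i = 0) →
            flagSum M B lam (flg m k) w = flagDet g r (xpos r lam) (flg m k) := by
          intro v
          induction v with
          | zero =>
            intro lam hv hl hr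
            have h1 : lam (k + 1) = 0 := by have := hl (show k ≤ k + 1 by omega); omega
            rw [flagSum_step_eq M B hl w m k (by omega) (by omega), ihj (by omega) lam hl hr]
            by_cases hkr : k + 1 < r
            · rw [flagDet_step_eq g r _ m k hkr]
              simp only [xpos]; omega
            · rw [flagDet_step_zero g r _ m k]
              simp only [xpos]; omega
          | succ v ihv =>
            intro lam hv hl hr
            by_cases hd : lam (k + 1) < lam k
            · rw [flagSum_step M B hl w m k hd (by omega) hm,
                flagDet_step g r _ m k (by omega) (by simp only [xpos]; omega),
                ihj (by omega) lam hl hr,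
                ihv (Function.update lam k (lam k - 1)) (by simp; omega) (update_antitone hl k hd),
                xpos_update r lam k (by omega), hg]
              · congr 3
                simp only [xpos]; omega
              · intro i hi
                rw [Function.update_of_ne (by omega)]
                exact hr i hi
            · have h1 : lam k = lam (k + 1) := by
                have := hl (show k ≤ k + 1 by omega); omega
              have hkr : k + 1 < r := by
                by_contra hh
                have := hr (k + 1) (by omega); omega
              rw [flagSum_step_eq M B hl w m k h1 (by omega), ihj (by omega) lam hl hr,
                flagDet_step_eq g r _ m k hkr]
              simp only [xpos]; omega
        intro lam hl hr
        exact inner _ lam rfl hl hr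
    intro lam hl hr
    have := key r le_rfl lam hl hr
    rw [Nat.sub_self] at this
    exact this

theorem zetaT_eq_det (M B r : ℕ) (hB : r ≤ B) (g : ℕ → ℕ → ℂ) (a : ℤ → ℂ)
    (hg : ∀ k s, g k s = (k : ℂ) ^ (-(a ((s : ℤ) + 1 - r))))
    (lam : ℕ → ℕ) (hl : Antitone lam) (hr : ∀ i, r ≤ i → lam i = 0) :
    zetaT M B lam (fun _ => 0) a =
      Matrix.det (Matrix.of fun j i : Fin r =>
        VVm g M (lam j + (r - 1 - (j : ℕ))) (r - 1 - (i : ℕ))) := by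
  have h := flag_main M B r hB g (fun k c => (k : ℂ) ^ (-(a c))) hg M le_rfl lam hl hr
  rw [show (Matrix.det (Matrix.of fun j i : Fin r =>
        VVm g M (lam j + (r - 1 - (j : ℕ))) (r - 1 - (i : ℕ)))) =
        flagDet g r (xpos r lam) (fun _ => M) from rfl, ← h]
  unfold zetaT zetaTF tabSum flagSum
  congr 1
  ext T
  simp

/-! ### Part B: a Plücker-type determinant identity -/

section PluckerDet

variable {α β : Type*} [Fintype α] [DecidableEq α] [Fintype β] [DecidableEq β]

lemma exists_swapPerm (t : ℕ) (q : ℕ → α) (p : ℕ → β)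
    (hq : ∀ i < t, ∀ j < t, q i = q j → i = j) (hp : ∀ i < t, ∀ j < t, p i = p j → i = j) :
    ∃ τ : Equiv.Perm (α ⊕ β), ((Equiv.Perm.sign τ : ℤ) : ℂ) = (-1) ^ t ∧
      (∀ j < t, τ (Sum.inl (q j)) = Sum.inr (p j)) ∧
      (∀ j < t, τ (Sum.inr (p j)) = Sum.inl (q j)) ∧
      (∀ a, (∀ j < t, a ≠ q j) → τ (Sum.inl a) = Sum.inl a) ∧
      (∀ b, (∀ j < t, b ≠ p j) → τ (Sum.inr b) = Sum.inr b) := by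
  induction t with
  | zero => exact ⟨1, by simp, by simp, by simp, by simp, by simp⟩
  | succ t ih =>
    obtain ⟨τ, h1, h2, h3, h4, h5⟩ := ih (fun i hi j hj => hq i (by omega) j (by omega))
      (fun i hi j hj => hp i (by omega) j (by omega))
    have hqt : ∀ j < t, q t ≠ q j := fun j hj h => by
      have := hq t (by omega) j (by omega) h; omega
    have hpt : ∀ j < t, p t ≠ p j := fun j hj h => by
      have := hp t (by omega) j (by omega) h; omega
    refine ⟨τ * Equiv.swap (Sum.inl (q t)) (Sum.inr (p t)), ?_, ?_, ?_, ?_, ?_⟩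
    · rw [Equiv.Perm.sign_mul, Equiv.Perm.sign_swap (by simp)]
      push_cast
      rw [h1, pow_succ]
    · intro j hj
      rw [Equiv.Perm.mul_apply]
      rcases Nat.lt_succ_iff_lt_or_eq.1 hj with hj | rfl
      · rw [Equiv.swap_apply_of_ne_of_ne, h2 j hj]
        · simpa using (hqt j hj).symm
        · simp
      · rw [Equiv.swap_apply_left, h5 _ hpt]
    · intro j hj
      rw [Equiv.Perm.mul_apply]
      rcases Nat.lt_succ_iff_lt_or_eq.1 hj with hj | rfl
      · rw [Equiv.swap_apply_of_ne_of_ne, h3 j hj]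
        · simp
        · simpa using (hpt j hj).symm
      · rw [Equiv.swap_apply_right, h4 _ hqt]
    · intro a ha
      rw [Equiv.Perm.mul_apply, Equiv.swap_apply_of_ne_of_ne, h4 a fun j hj => ha j (by omega)]
      · simpa using ha t (by omega)
      · simp
    · intro b hb
      rw [Equiv.Perm.mul_apply, Equiv.swap_apply_of_ne_of_ne, h5 b fun j hj => hb j (by omega)]
      · simp
      · simpa using hb t (by omega)

/-- vector placed in the first block -/
def topV (v : α → ℂ) : α ⊕ β → ℂ := Sum.elim v 0

/-- restriction of a vector placed in the second block -/
def botV (e : β → α) (v : α → ℂ) : α ⊕ β → ℂ := Sum.elim 0 (fun b => v (e b))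

/-- default rows -/
def rowsD (e : β → α) (X : α → α → ℂ) (Y : β → α → ℂ) : α ⊕ β → α ⊕ β → ℂ :=
  Sum.elim (fun j => topV (X j)) (fun k => botV e (Y k))

/-- moved rows -/
def rowsM (e : β → α) (X : α → α → ℂ) (Y : β → α → ℂ) : α ⊕ β → α ⊕ β → ℂ :=
  Sum.elim (fun j => botV e (X j)) (fun k => topV (Y k))

lemma pl_expand (e : β → α) (X : α → α → ℂ) (Y : β → α → ℂ) (T : Finset (α ⊕ β)) :
    Matrix.det (Matrix.of (T.piecewise (rowsM e X Y + rowsD e X Y) (rowsD e X Y))) =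
      ∑ s ∈ T.powerset, Matrix.det (Matrix.of (s.piecewise (rowsM e X Y) (rowsD e X Y))) :=
  (Matrix.detRowAlternating (R := ℂ) (n := α ⊕ β)).toMultilinearMap.map_piecewise_add _ _ T

lemma pl_term (e : β → α) (X : α → α → ℂ) (Y : β → α → ℂ) (t : ℕ) (q : ℕ → α) (p : ℕ → β)
    (hq : ∀ i < t, ∀ j < t, q i = q j → i = j) (hp : ∀ i < t, ∀ j < t, p i = p j → i = j)
    (s : Finset (α ⊕ β)) (hs1 : ∀ a, Sum.inl a ∈ s ↔ ∃ j < t, a = q j)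
    (hs2 : ∀ b, Sum.inr b ∈ s ↔ ∃ j < t, b = p j)
    (X' : α → α → ℂ) (Y' : β → α → ℂ)
    (hX1 : ∀ j < t, X' (q j) = Y (p j)) (hX2 : ∀ a, (∀ j < t, a ≠ q j) → X' a = X a)
    (hY1 : ∀ j < t, Y' (p j) = X (q j)) (hY2 : ∀ b, (∀ j < t, b ≠ p j) → Y' b = Y b) :
    Matrix.det (Matrix.of (s.piecewise (rowsM e X Y) (rowsD e X Y))) =
      (-1) ^ t * (Matrix.det (Matrix.of X') *
        Matrix.det (Matrix.of fun k i : β => Y' k (e i))) := by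
  obtain ⟨τ, h1, h2, h3, h4, h5⟩ := exists_swapPerm t q p hq hp
  have hperm := Matrix.det_permute τ (Matrix.of (s.piecewise (rowsM e X Y) (rowsD e X Y)))
  have hblock : (Matrix.of (s.piecewise (rowsM e X Y) (rowsD e X Y))).submatrix τ id =
      Matrix.fromBlocks (Matrix.of X') 0 0 (Matrix.of fun k i : β => Y' k (e i)) := by
    ext z c
    rcases z with a | b
    · by_cases ha : ∃ j < t, a = q j
      · obtain ⟨j, hj, rfl⟩ := ha
        rw [Matrix.submatrix_apply, h2 j hj, Matrix.of_apply,
          Finset.piecewise_eq_of_mem _ _ _ ((hs2 _).2 ⟨j, hj, rfl⟩)]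
        rcases c with c | c <;> simp [rowsM, topV, hX1 j hj]
      · rw [Matrix.submatrix_apply, h4 a (by push Not at ha; exact ha), Matrix.of_apply,
          Finset.piecewise_eq_of_notMem _ _ _ (fun h => ha ((hs1 _).1 h))]
        have := hX2 a (by push Not at ha; exact ha)
        rcases c with c | c <;> simp [rowsD, topV, this]
    · by_cases hb : ∃ j < t, b = p j
      · obtain ⟨j, hj, rfl⟩ := hb
        rw [Matrix.submatrix_apply, h3 j hj, Matrix.of_apply,
          Finset.piecewise_eq_of_mem _ _ _ ((hs1 _).2 ⟨j, hj, rfl⟩)]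
        rcases c with c | c <;> simp [rowsM, botV, hY1 j hj]
      · rw [Matrix.submatrix_apply, h5 b (by push Not at hb; exact hb), Matrix.of_apply,
          Finset.piecewise_eq_of_notMem _ _ _ (fun h => hb ((hs2 _).1 h))]
        have := hY2 b (by push Not at hb; exact hb)
        rcases c with c | c <;> simp [rowsD, botV, this]
  rw [hblock, Matrix.det_fromBlocks_zero₂₁, h1] at hperm
  rw [hperm, ← mul_assoc, ← mul_pow]; simp

lemma pl_main (e : β → α) (X : α → α → ℂ) (Y : β → α → ℂ) (t : ℕ) (q : ℕ → α) (p : ℕ → β)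
    (hq : ∀ i < t, ∀ j < t, q i = q j → i = j) (hp : ∀ i < t, ∀ j < t, p i = p j → i = j)
    (T : Finset (α ⊕ β)) (hs1 : ∀ a, Sum.inl a ∈ T ↔ ¬ ∃ j < t, a = q j)
    (hs2 : ∀ b, Sum.inr b ∈ T ↔ ∃ j < t, b = p j)
    (X' : α → α → ℂ) (Y' : β → α → ℂ)
    (hX1 : ∀ j < t, X' (q j) = Y (p j)) (hX2 : ∀ a, (∀ j < t, a ≠ q j) → X' a = X a)
    (hY1 : ∀ j < t, Y' (p j) = X (q j)) (hY2 : ∀ b, (∀ j < t, b ≠ p j) → Y' b = Y b) :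
    Matrix.det (Matrix.of (T.piecewise (rowsM e X Y + rowsD e X Y) (rowsD e X Y))) =
      Matrix.det (Matrix.of X') * Matrix.det (Matrix.of fun k i : β => Y' k (e i)) := by
  classical
  obtain ⟨τ, h1, h2, h3, h4, h5⟩ := exists_swapPerm t q p hq hp
  set S : Matrix α β ℂ := Matrix.of fun a b => if a = e b then -1 else 0 with hS
  set D := Matrix.of (T.piecewise (rowsM e X Y + rowsD e X Y) (rowsD e X Y)) with hD
  set E : Matrix (α ⊕ β) (α ⊕ β) ℂ := Matrix.fromBlocks 1 S 0 1 with hE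
  have hdet : (D * E).det = D.det := by
    rw [Matrix.det_mul, hE, Matrix.det_fromBlocks_zero₂₁]; simp
  have hmul : ∀ z : α ⊕ β, (∀ c : α, (D * E) z (Sum.inl c) = D z (Sum.inl c)) ∧
      (∀ c : β, (D * E) z (Sum.inr c) =
        D z (Sum.inr c) - D z (Sum.inl (e c))) := by
    intro z
    constructor
    · intro c
      rw [Matrix.mul_apply, Fintype.sum_sum_type]
      simp [hE, Matrix.one_apply]
    · intro c
      rw [Matrix.mul_apply, Fintype.sum_sum_type]
      simp [hE, Matrix.one_apply, hS]
      ring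
  set ε : β → ℂ := fun b => if ∃ j < t, b = p j then -1 else 1 with hε
  have hblock : (D * E).submatrix τ id =
      Matrix.fromBlocks (Matrix.of X') 0
        (Matrix.of fun b a => (D * E) (τ (Sum.inr b)) (Sum.inl a))
        (Matrix.of fun k i : β => ε k * Y' k (e i)) := by
    ext z c
    rcases z with a | b
    · by_cases ha : ∃ j < t, a = q j
      · obtain ⟨j, hj, rfl⟩ := ha
        have hDr : D (Sum.inr (p j)) = topV (Y (p j)) + botV e (Y (p j)) := by
          rw [hD]; funext c
          rw [Matrix.of_apply, Finset.piecewise_eq_of_mem _ _ _ ((hs2 _).2 ⟨j, hj, rfl⟩)]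
          simp [rowsM, rowsD]
        rw [Matrix.submatrix_apply, h2 j hj]
        rcases c with c | c
        · rw [id, (hmul _).1, hDr]; simp [topV, botV, hX1 j hj]
        · rw [id, (hmul _).2, hDr]; simp [topV, botV]
      · have ha' : ∀ j < t, a ≠ q j := by push Not at ha; exact ha
        have hDr : D (Sum.inl a) = topV (X a) + botV e (X a) := by
          rw [hD]; funext c
          rw [Matrix.of_apply, Finset.piecewise_eq_of_mem _ _ _ ((hs1 _).2 ha)]
          simp [rowsM, rowsD]; ring
        rw [Matrix.submatrix_apply, h4 a ha']
        rcases c with c | c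
        · rw [id, (hmul _).1, hDr]; simp [topV, botV, hX2 a ha']
        · rw [id, (hmul _).2, hDr]; simp [topV, botV]
    · rcases c with c | c
      · simp
      by_cases hb : ∃ j < t, b = p j
      · obtain ⟨j, hj, rfl⟩ := hb
        have hDr : D (Sum.inl (q j)) = topV (X (q j)) := by
          rw [hD]; funext c
          rw [Matrix.of_apply, Finset.piecewise_eq_of_notMem _ _ _
            (fun h => (hs1 _).1 h ⟨j, hj, rfl⟩)]
          simp [rowsD]
        have hεj : ε (p j) = -1 := if_pos ⟨j, hj, rfl⟩
        rw [Matrix.submatrix_apply, h3 j hj, id, (hmul _).2, hDr]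
        simp [topV, hY1 j hj, hεj]
      · have hb' : ∀ j < t, b ≠ p j := by push Not at hb; exact hb
        have hDr : D (Sum.inr b) = botV e (Y b) := by
          rw [hD]; funext c
          rw [Matrix.of_apply, Finset.piecewise_eq_of_notMem _ _ _
            (fun h => hb ((hs2 _).1 h))]
          simp [rowsD]
        have hεj : ε b = 1 := if_neg hb
        rw [Matrix.submatrix_apply, h5 b hb', id, (hmul _).2, hDr]
        simp [botV, hY2 b hb', hεj]
  have hprod : ∏ b, ε b = (-1) ^ t := by
    rw [hε, Finset.prod_ite]
    simp only [Finset.prod_const, one_pow, mul_one]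
    congr 1
    have : (Finset.univ.filter fun b => ∃ j < t, b = p j) = (Finset.range t).image p := by
      ext b; simp [eq_comm]
    rw [this, Finset.card_image_of_injOn, Finset.card_range]
    intro i hi j hj h
    exact hp i (by simpa using hi) j (by simpa using hj) h
  have hperm := Matrix.det_permute τ (D * E)
  rw [hblock, Matrix.det_fromBlocks_zero₁₂, h1, hdet] at hperm
  have hcol := Matrix.det_mul_column ε (Matrix.of fun k i : β => Y' k (e i))
  simp only [Matrix.of_apply] at hcol
  rw [hcol, hprod] at hperm
  have h11 : ((-1 : ℂ) ^ t) * (-1) ^ t = 1 := by rw [← mul_pow]; simp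
  linear_combination (-(-1 : ℂ) ^ t) * hperm +
    (Matrix.det (Matrix.of X') * Matrix.det (Matrix.of fun k i : β => Y' k (e i)) - D.det) * h11

lemma pl_card (e : β → α) (X : α → α → ℂ) (Y : β → α → ℂ) (s : Finset (α ⊕ β))
    (h : Matrix.det (Matrix.of (s.piecewise (rowsM e X Y) (rowsD e X Y))) ≠ 0) :
    s.toLeft.card = s.toRight.card := by
  classical
  rw [Matrix.det_apply] at h
  obtain ⟨σ, -, hσ⟩ := Finset.exists_ne_zero_of_sum_ne_zero h
  have hσ' : ∀ i, (s.piecewise (rowsM e X Y) (rowsD e X Y)) (σ i) i ≠ 0 := by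
    intro i hi
    apply hσ
    rw [Finset.prod_eq_zero (Finset.mem_univ i) (by exact hi), smul_zero]
  have hτ : ∀ z, (s.piecewise (rowsM e X Y) (rowsD e X Y)) z (σ.symm z) ≠ 0 := by
    intro z; simpa using hσ' (σ.symm z)
  have hiff : ∀ z, (σ.symm z).isLeft = true ↔ (z.isLeft = true ∧ z ∉ s) ∨ (z.isRight = true ∧ z ∈ s) := by
    intro z
    have := hτ z
    by_cases hz : z ∈ s
    · rw [Finset.piecewise_eq_of_mem _ _ _ hz] at this
      rcases z with a | b <;> rcases hc : σ.symm _ with c | c <;>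
        simp_all [rowsM, topV, botV]
    · rw [Finset.piecewise_eq_of_notMem _ _ _ hz] at this
      rcases z with a | b <;> rcases hc : σ.symm _ with c | c <;>
        simp_all [rowsD, topV, botV]
  have hc1 : (Finset.univ.filter fun z : α ⊕ β => (σ.symm z).isLeft = true).card =
      (Finset.univ.filter fun z : α ⊕ β => z.isLeft = true).card := by
    apply Finset.card_bij (fun z _ => σ.symm z)
    · intro z hz; simpa using hz
    · intro z _ z' _ h; exact σ.symm.injective h
    · intro z hz; exact ⟨σ z, by simpa using hz, by simp⟩
  have hsum : (∑ z : α ⊕ β, if (σ.symm z).isLeft = true then (1 : ℤ) else 0) =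
      ∑ z : α ⊕ β, if z.isLeft = true then (1 : ℤ) else 0 := by
    rw [Finset.sum_boole, Finset.sum_boole, hc1]
  have hL : (s.toLeft.card : ℤ) = ∑ a : α, if Sum.inl a ∈ s then (1 : ℤ) else 0 := by
    rw [Finset.sum_boole]
    congr 2; ext a; simp
  have hR : (s.toRight.card : ℤ) = ∑ b : β, if Sum.inr b ∈ s then (1 : ℤ) else 0 := by
    rw [Finset.sum_boole]
    congr 2; ext a; simp
  simp only [hiff, Fintype.sum_sum_type] at hsum
  have e1 : ∀ a : α, (if ((Sum.inl a : α ⊕ β).isLeft = true ∧ (Sum.inl a : α ⊕ β) ∉ s) ∨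
      ((Sum.inl a : α ⊕ β).isRight = true ∧ (Sum.inl a : α ⊕ β) ∈ s) then (1 : ℤ) else 0) =
      1 - if (Sum.inl a : α ⊕ β) ∈ s then (1 : ℤ) else 0 := by
    intro a; by_cases ha : (Sum.inl a : α ⊕ β) ∈ s <;> simp [ha]
  have e2 : ∀ b : β, (if ((Sum.inr b : α ⊕ β).isLeft = true ∧ (Sum.inr b : α ⊕ β) ∉ s) ∨
      ((Sum.inr b : α ⊕ β).isRight = true ∧ (Sum.inr b : α ⊕ β) ∈ s) then (1 : ℤ) else 0) =
      if (Sum.inr b : α ⊕ β) ∈ s then (1 : ℤ) else 0 := by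
    intro a; by_cases ha : (Sum.inr a : α ⊕ β) ∈ s <;> simp [ha]
  simp only [e1, e2, Finset.sum_sub_distrib, ← hL, ← hR] at hsum
  simp at hsum
  omega

lemma pl_vanishL (e : β → α) (X : α → α → ℂ) (Y : β → α → ℂ) (s : Finset (α ⊕ β)) (a : α) (b : β)
    (ha : Sum.inl a ∈ s) (hb : Sum.inr b ∉ s) (h : X a = Y b) :
    Matrix.det (Matrix.of (s.piecewise (rowsM e X Y) (rowsD e X Y))) = 0 := by
  apply Matrix.det_zero_of_row_eq (i := Sum.inl a) (j := Sum.inr b) (by simp)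
  show s.piecewise (rowsM e X Y) (rowsD e X Y) (Sum.inl a) =
    s.piecewise (rowsM e X Y) (rowsD e X Y) (Sum.inr b)
  rw [Finset.piecewise_eq_of_mem _ _ _ ha, Finset.piecewise_eq_of_notMem _ _ _ hb]
  simp [rowsM, rowsD, h]

lemma pl_vanishR (e : β → α) (X : α → α → ℂ) (Y : β → α → ℂ) (s : Finset (α ⊕ β)) (a : α) (b : β)
    (ha : Sum.inl a ∉ s) (hb : Sum.inr b ∈ s) (h : X a = Y b) :
    Matrix.det (Matrix.of (s.piecewise (rowsM e X Y) (rowsD e X Y))) = 0 := by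
  apply Matrix.det_zero_of_row_eq (i := Sum.inl a) (j := Sum.inr b) (by simp)
  show s.piecewise (rowsM e X Y) (rowsD e X Y) (Sum.inl a) =
    s.piecewise (rowsM e X Y) (rowsD e X Y) (Sum.inr b)
  rw [Finset.piecewise_eq_of_mem _ _ _ hb, Finset.piecewise_eq_of_notMem _ _ _ ha]
  simp [rowsM, rowsD, h]

end PluckerDet

/-! ### Part C: the operators on partitions and sorting -/

lemma exists_cyc (N a b : ℕ) (hab : a ≤ b) (hb : b < N) :
    ∃ c : Equiv.Perm (Fin N), Equiv.Perm.sign c = (-1) ^ (b - a) ∧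
      ∀ k : Fin N, ((c k : Fin N) : ℕ) =
        if (k : ℕ) < a then (k : ℕ) else if (k : ℕ) < b then (k : ℕ) + 1
        else if (k : ℕ) = b then a else (k : ℕ) := by
  have : NeZero N := ⟨by omega⟩
  refine ⟨Fin.cycleIcc ⟨a, by omega⟩ ⟨b, hb⟩, ?_, ?_⟩
  · rw [Fin.sign_cycleIcc_of_le (by simpa using hab)]
  · intro k
    split_ifs with h1 h2 h3
    · rw [Fin.cycleIcc_of_lt (by simpa [Fin.lt_def] using h1)]
    · rw [Fin.cycleIcc_of_ge_of_lt (by simpa [Fin.le_def] using h1) (by simpa [Fin.lt_def] using h2)]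
      rw [Fin.val_add_one_of_lt' (by omega)]
    · have : k = ⟨b, hb⟩ := Fin.ext h3
      rw [this, Fin.cycleIcc_of_last (by simpa using hab)]
    · rw [Fin.cycleIcc_of_gt (by simp [Fin.lt_def]; omega)]

lemma exists_cyc_inv (N a b : ℕ) (hab : a ≤ b) (hb : b < N) :
    ∃ c : Equiv.Perm (Fin N), Equiv.Perm.sign c = (-1) ^ (b - a) ∧
      ∀ k : Fin N, ((c k : Fin N) : ℕ) =
        if (k : ℕ) < a then (k : ℕ) else if (k : ℕ) = a then b
        else if (k : ℕ) ≤ b then (k : ℕ) - 1 else (k : ℕ) := by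
  obtain ⟨c, hs, hc⟩ := exists_cyc N a b hab hb
  refine ⟨c⁻¹, by rw [Equiv.Perm.sign_inv, hs], ?_⟩
  intro k
  have h := hc (c⁻¹ k)
  rw [show c (c⁻¹ k) = k from Equiv.apply_symm_apply c k] at h
  split_ifs at h ⊢ <;> omega

lemma iterOp_succ (op : ℕ → ℕ → (ℕ → ℕ) → ℕ → ℕ) (t : ℕ) (a b k : ℕ → ℕ) :
    iterOp op (t + 1) a b k =
      op (a 0) (b 0) (iterOp op t (fun i => a (i + 1)) (fun i => b (i + 1)) k) := by
  unfold iterOp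
  rw [List.range_succ_eq_map]
  simp [List.foldr_map]

lemma iter_sort (R : ℕ) (k : ℕ → ℕ) (hk : Antitone k) (hk0 : ∀ i, R ≤ i → k i = 0) (t : ℕ) :
    ∀ (a b : ℕ → ℕ), (∀ j < t, 1 ≤ a j ∧ a j ≤ b j ∧ b j ≤ R ∧ k (a j) < k (a j - 1) ∧
        k (b j) < k (b j - 1)) → (∀ i j, i < j → j < t → a i < a j ∧ b j < b i) →
    ∃ (x y : ℕ → ℕ) (σ : Equiv.Perm (Fin (R + 1))) (σ' : Equiv.Perm (Fin R)),
      Equiv.Perm.sign σ = Equiv.Perm.sign σ' ∧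
      (∀ j < t, x (b j) = k (a j - 1) + (R - 1 - (a j - 1))) ∧
      (∀ i, (∀ j < t, i ≠ b j) → x i = k i + (R - i)) ∧
      (∀ j < t, y (a j - 1) = k (b j) + (R - b j)) ∧
      (∀ i, (∀ j < t, i ≠ a j - 1) → y i = k i + (R - 1 - i)) ∧
      (∀ j : Fin (R + 1), iterOp AddOp t a b k j + (R - j) = x (σ j)) ∧
      (∀ j : Fin R, iterOp RemOp t a b k j + (R - 1 - j) = y (σ' j)) ∧
      Antitone (iterOp AddOp t a b k) ∧ Antitone (iterOp RemOp t a b k) ∧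
      (∀ i, R + 1 ≤ i → iterOp AddOp t a b k i = 0) ∧
      (∀ i, R ≤ i → iterOp RemOp t a b k i = 0) ∧
      (∀ i, (∀ j < t, i < a j ∨ b j < i) → iterOp AddOp t a b k i = k i) ∧
      (∀ i, (∀ j < t, i + 1 < a j ∨ b j < i + 1) → iterOp RemOp t a b k i = k i) ∧
      (∀ i : Fin (R + 1), (∀ j < t, (i : ℕ) < a j ∨ b j < i) → σ i = i) ∧
      (∀ i : Fin R, (∀ j < t, (i : ℕ) + 1 < a j ∨ b j < (i : ℕ) + 1) → σ' i = i) := by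
  induction t with
  | zero =>
    intro a b _ _
    refine ⟨fun i => k i + (R - i), fun i => k i + (R - 1 - i), 1, 1, ?_⟩
    simp [iterOp, hk]
    exact ⟨fun i hi => hk0 i (by omega), hk0⟩
  | succ t ih =>
    intro a b h1 h2
    obtain ⟨x, y, σ, σ', hs, hx1, hx2, hy1, hy2, hA, hB, hAa, hBa, hA0, hB0, hAl, hBl, hσl, hσl'⟩ :=
      ih (fun i => a (i + 1)) (fun i => b (i + 1)) (fun j hj => h1 (j + 1) (by omega))
        (fun i j hij hj => h2 (i + 1) (j + 1) (by omega) (by omega))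
    rw [iterOp_succ, iterOp_succ]
    set A := iterOp AddOp t (fun i => a (i + 1)) (fun i => b (i + 1)) k with hAdef
    set B := iterOp RemOp t (fun i => a (i + 1)) (fun i => b (i + 1)) k with hBdef
    obtain ⟨ha0, hab0, hbR, hka, hkb⟩ := h1 0 (by omega)
    have h20 : ∀ j < t, a 0 < a (j + 1) ∧ b (j + 1) < b 0 := fun j hj =>
      h2 0 (j + 1) (by omega) (by omega)
    have h1s : ∀ j < t, a (j + 1) ≤ b (j + 1) := fun j hj => (h1 (j + 1) (by omega)).2.1
    generalize ha : a 0 = p at *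
    generalize hb : b 0 = q at *
    have hAle : ∀ i, i ≤ p → A i = k i := fun i hi => hAl i fun j hj => by
      have := h20 j hj; omega
    have hAge : ∀ i, q ≤ i → A i = k i := fun i hi => hAl i fun j hj => by
      have := h20 j hj; omega
    have hBle : ∀ i, i < p → B i = k i := fun i hi => hBl i fun j hj => by
      have := h20 j hj; omega
    have hBge : ∀ i, q - 1 ≤ i → B i = k i := fun i hi => hBl i fun j hj => by
      have := h20 j hj; omega
    obtain ⟨c, hcs, hc⟩ := exists_cyc_inv (R + 1) p q hab0 (by omega)
    obtain ⟨c', hcs', hc'⟩ := exists_cyc R (p - 1) (q - 1) (by omega) (by omega)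
    have hσfix : ∀ i : Fin (R + 1), (i : ℕ) = q → σ i = i := fun i hi => hσl i fun j hj => by
      have := h20 j hj; omega
    have hσfix' : ∀ i : Fin R, (i : ℕ) = p - 1 → σ' i = i := fun i hi => hσl' i fun j hj => by
      have := h20 j hj; omega
    have hσne : ∀ i : Fin (R + 1), (i : ℕ) ≠ q → ((σ i : Fin (R + 1)) : ℕ) ≠ q := by
      intro i hi hq
      have := hσfix (σ i) hq
      rw [σ.injective this] at hq
      exact hi hq
    have hσne' : ∀ i : Fin R, (i : ℕ) ≠ p - 1 → ((σ' i : Fin R) : ℕ) ≠ p - 1 := by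
      intro i hi hq
      have := hσfix' (σ' i) hq
      rw [σ'.injective this] at hq
      exact hi hq
    refine ⟨Function.update x q (k (p - 1) + (R - 1 - (p - 1))),
      Function.update y (p - 1) (k q + (R - q)), σ * c, σ' * c', ?_, ?_, ?_, ?_, ?_, ?_, ?_, ?_, ?_,
      ?_, ?_, ?_, ?_, ?_, ?_⟩
    · rw [Equiv.Perm.sign_mul, Equiv.Perm.sign_mul, hs, hcs, hcs']
      congr 2; omega
    · intro j hj
      rcases j with _ | j
      · simp [ha, hb]
      · rw [Function.update_of_ne (by have := h20 j (by omega); omega)]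
        exact hx1 j (by omega)
    · intro i hi
      rw [Function.update_of_ne (by have := hi 0 (by omega); omega)]
      exact hx2 i fun j hj => hi (j + 1) (by omega)
    · intro j hj
      rcases j with _ | j
      · simp [ha, hb]
      · rw [Function.update_of_ne (by have := h20 j (by omega); omega)]
        exact hy1 j (by omega)
    · intro i hi
      rw [Function.update_of_ne (by have := hi 0 (by omega); rw [ha] at this; exact this)]
      exact hy2 i fun j hj => hi (j + 1) (by omega)
    · intro j
      rw [Equiv.Perm.mul_apply]
      have hcj := hc j
      unfold AddOp
      by_cases hjp : (j : ℕ) = p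
      · rw [if_neg (by omega), if_pos (by omega)] at hcj
        rw [if_neg (by omega), if_pos (by omega)]
        rw [hσfix _ hcj, hcj, Function.update_self, hAle _ (by omega)]
        omega
      · have hcq : ((c j : Fin (R + 1)) : ℕ) ≠ q := by
          rw [hcj]; split_ifs <;> omega
        rw [Function.update_of_ne (hσne _ hcq), ← hA, hcj]
        have := j.2
        split_ifs <;> omega
    · intro j
      rw [Equiv.Perm.mul_apply]
      have hcj := hc' j
      unfold RemOp
      by_cases hjp : (j : ℕ) = q - 1
      · rw [if_neg (by omega), if_neg (by omega), if_pos (by omega)] at hcj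
        rw [if_neg (by omega), if_neg (by omega), if_pos (by omega)]
        rw [hσfix' _ hcj, hcj, Function.update_self, hBge _ (by omega)]
        omega
      · have hcq : ((c' j : Fin R) : ℕ) ≠ p - 1 := by
          rw [hcj]; split_ifs <;> omega
        rw [Function.update_of_ne (hσne' _ hcq), ← hB, hcj]
        have := j.2
        have hpos : (j : ℕ) + 1 ≤ q - 1 → 1 ≤ B (j + 1) := fun h => by
          have e1 := hBa h
          rw [hBge _ le_rfl] at e1; omega
        split_ifs <;> omega
    · apply antitone_nat_of_succ_le
      intro i
      have e0 := hAa (Nat.le_succ i)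
      have e1 : A i ≤ A (i - 1) := hAa (Nat.sub_le i 1)
      have e2 := hAle p le_rfl
      have e3 := hAle (p - 1) (by omega)
      have e4 : i + 1 ≤ p ∨ i = p ∨ p + 1 ≤ i := by omega
      unfold AddOp
      simp only [Nat.succ_eq_add_one] at e0
      rcases e4 with e4 | e4 | e4
      · by_cases e5 : i + 1 = p
        · subst e5
          simp
        · split_ifs <;> omega
      · subst e4
        have e6 : i + 1 - 1 = i := by omega
        rw [e6]
        split_ifs <;> omega
      · have e6 : i + 1 - 1 = i := by omega
        rw [e6]
        split_ifs <;> omega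
    · apply antitone_nat_of_succ_le
      intro i
      have e0 : B (i + 1) ≤ B i := hBa (Nat.le_succ i)
      have e1 : B (i + 1 + 1) ≤ B (i + 1) := hBa (Nat.le_succ (i + 1))
      have e2 := hBge (q - 1) le_rfl
      have e3 := hBge q (by omega)
      have e4 : i + 2 < q ∨ i + 1 + 1 = q ∨ i + 1 = q ∨ q ≤ i := by omega
      unfold RemOp
      rcases e4 with e4 | e4 | e4 | e4
      · split_ifs <;> omega
      · subst e4
        rw [show i + 1 + 1 - 1 = i + 1 by omega] at *
        split_ifs <;> omega
      · subst e4
        rw [show i + 1 - 1 = i by omega] at *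
        split_ifs <;> omega
      · split_ifs <;> omega
    · intro i hi
      unfold AddOp
      rw [if_neg (by omega), if_neg (by omega), if_neg (by omega)]
      exact hA0 i hi
    · intro i hi
      unfold RemOp
      rw [if_neg (by omega), if_neg (by omega), if_neg (by omega)]
      exact hB0 i hi
    · intro i hi
      have h0 := hi 0 (by omega)
      rw [ha, hb] at h0
      rw [← hAl i fun j hj => hi (j + 1) (by omega)]
      unfold AddOp
      split_ifs <;> omega
    · intro i hi
      have h0 := hi 0 (by omega)
      rw [ha, hb] at h0
      rw [← hBl i fun j hj => hi (j + 1) (by omega)]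
      unfold RemOp
      split_ifs <;> omega
    · intro i hi
      have h0 := hi 0 (by omega)
      rw [ha, hb] at h0
      have : c i = i := by
        apply Fin.ext; rw [hc]; split_ifs <;> omega
      rw [Equiv.Perm.mul_apply, this]
      exact hσl i fun j hj => hi (j + 1) (by omega)
    · intro i hi
      have h0 := hi 0 (by omega)
      rw [ha, hb] at h0
      have : c' i = i := by
        apply Fin.ext; rw [hc']; split_ifs <;> omega
      rw [Equiv.Perm.mul_apply, this]
      exact hσl' i fun j hj => hi (j + 1) (by omega)

/-! ### Part D: facts on step partitions and sorted finite sets -/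

lemma ascNth_eq (s : Finset ℕ) (i : ℕ) (h : i < (s.sort (· ≤ ·)).length) :
    ascNth s i = (s.sort (· ≤ ·))[i] := by
  unfold ascNth
  rw [List.getD_eq_getElem _ _ h]

lemma ascNth_mem (s : Finset ℕ) (i : ℕ) (h : i < s.card) : ascNth s i ∈ s := by
  rw [ascNth_eq s i (by simpa using h)]
  have := List.getElem_mem (l := s.sort (· ≤ ·)) (n := i) (by simpa using h)
  exact (Finset.mem_sort _).1 this

lemma ascNth_lt (s : Finset ℕ) (i j : ℕ) (hij : i < j) (h : j < s.card) :
    ascNth s i < ascNth s j := by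
  rw [ascNth_eq s i (by simp; omega), ascNth_eq s j (by simpa using h)]
  exact List.pairwise_iff_getElem.1 (Finset.sortedLT_sort s).pairwise i j _ _ hij

lemma ascNth_surj (s : Finset ℕ) (x : ℕ) (hx : x ∈ s) : ∃ j < s.card, x = ascNth s j := by
  have : x ∈ s.sort (· ≤ ·) := by simpa using hx
  obtain ⟨j, hj, rfl⟩ := List.getElem_of_mem this
  exact ⟨j, by simpa using hj, (ascNth_eq s j hj).symm⟩

section StepPart

variable (n : ℕ) (m rr : ℕ → ℕ)

lemma rr_lt (hrr : ∀ j, j + 1 < n → rr j < rr (j + 1)) (i j : ℕ) (hij : i < j) (hj : j < n) :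
    rr i < rr j := by
  induction j with
  | zero => omega
  | succ j ih =>
    have h1 := hrr j hj
    rcases Nat.lt_succ_iff_lt_or_eq.1 hij with h | rfl
    · have := ih h (by omega); omega
    · exact h1

lemma stepPart_eq (p i : ℕ) (hp : p < n) (hi : i < rr p) (h : ∀ j < p, rr j ≤ i) :
    stepPart n m rr i = m p := by
  unfold stepPart
  have hne : (((Finset.range n).filter fun j => i < rr j)).Nonempty := ⟨p, by simp [hp, hi]⟩
  rw [dif_pos hne]
  congr 1
  apply le_antisymm
  · exact Finset.min'_le _ _ (by simp [hp, hi])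
  · apply Finset.le_min'
    intro y hy
    simp only [Finset.mem_filter, Finset.mem_range] at hy
    by_contra hlt
    have := h y (by omega)
    omega

lemma stepPart_zero (i : ℕ) (h : ∀ j < n, rr j ≤ i) : stepPart n m rr i = 0 := by
  unfold stepPart
  rw [dif_neg]
  rintro ⟨y, hy⟩
  simp only [Finset.mem_filter, Finset.mem_range] at hy
  have := h y hy.1
  omega

lemma stepPart_cases (i : ℕ) :
    (∀ j < n, rr j ≤ i) ∨ ∃ p < n, i < rr p ∧ ∀ j < p, rr j ≤ i := by
  classical
  by_cases h : ∃ p, p < n ∧ i < rr p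
  · right
    refine ⟨Nat.find h, (Nat.find_spec h).1, (Nat.find_spec h).2, ?_⟩
    intro j hj
    have := Nat.find_min h hj
    have := (Nat.find_spec h).1
    by_contra hc
    exact Nat.find_min h hj ⟨by omega, by omega⟩
  · left
    push Not at h
    exact h

lemma stepPart_const (i : ℕ) (h : ∀ p < n, i + 1 ≠ rr p) :
    stepPart n m rr (i + 1) = stepPart n m rr i := by
  rcases stepPart_cases n rr (i + 1) with h1 | ⟨p, hp, hip, hj⟩
  · rw [stepPart_zero n m rr _ h1, stepPart_zero n m rr i]
    intro j hj
    have := h1 j hj; have := h j hj; omega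
  · rw [stepPart_eq n m rr p _ hp hip hj, stepPart_eq n m rr p i hp (by omega)]
    intro j hjp
    have := hj j hjp; have := h j (by omega); omega

lemma stepPart_drop (hm : ∀ j, j + 1 < n → m (j + 1) < m j) (hmpos : 0 < m (n - 1))
    (hrr : ∀ j, j + 1 < n → rr j < rr (j + 1)) (hrrpos : 0 < rr 0) (p : ℕ) (hp : p < n) :
    stepPart n m rr (rr p) < stepPart n m rr (rr p - 1) := by
  have hpos : 0 < rr p := by
    rcases Nat.eq_zero_or_pos p with rfl | h
    · exact hrrpos
    · have := rr_lt n rr hrr 0 p h hp; omega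
  rw [stepPart_eq n m rr p (rr p - 1) hp (by omega)
    (fun j hj => by have := rr_lt n rr hrr j p hj hp; omega)]
  by_cases h : p + 1 < n
  · rw [stepPart_eq n m rr (p + 1) (rr p) h (hrr p h)]
    · exact hm p h
    · intro j hj
      rcases Nat.lt_succ_iff_lt_or_eq.1 hj with h' | rfl
      · exact (rr_lt n rr hrr j p h' hp).le
      · exact le_rfl
  · have e : p = n - 1 := by omega
    rw [stepPart_zero, e]
    · exact hmpos
    · intro j hj
      rcases Nat.lt_or_ge j p with h' | h'
      · exact (rr_lt n rr hrr j p h' hp).le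
      · rw [show j = p by omega]

lemma stepPart_antitone (hm : ∀ j, j + 1 < n → m (j + 1) < m j) (hmpos : 0 < m (n - 1))
    (hrr : ∀ j, j + 1 < n → rr j < rr (j + 1)) (hrrpos : 0 < rr 0) :
    Antitone (stepPart n m rr) := by
  apply antitone_nat_of_succ_le
  intro i
  by_cases h : ∃ p < n, i + 1 = rr p
  · obtain ⟨p, hp, h⟩ := h
    have := stepPart_drop n m rr hm hmpos hrr hrrpos p hp
    rw [← h, Nat.add_sub_cancel] at this
    exact this.le
  · push Not at h
    exact (stepPart_const n m rr i h).le

end StepPart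

/-! ### Part E: assembly -/

/-- determinant attached to a partition with `R + 1` rows -/
noncomputable def FF (R : ℕ) (v : ℕ → Fin (R + 1) → ℂ) (k : ℕ → ℕ) : ℂ :=
  Matrix.det (Matrix.of fun j : Fin (R + 1) => v (k j + (R - j)))

/-- determinant attached to a partition with `R` rows -/
noncomputable def GG (R : ℕ) (v : ℕ → Fin (R + 1) → ℂ) (k : ℕ → ℕ) : ℂ :=
  Matrix.det (Matrix.of fun j i : Fin R => v (k j + (R - 1 - j)) i.succ)

/-- the determinant of the family of rows indexed by `s` -/
noncomputable def DD (R : ℕ) (v : ℕ → Fin (R + 1) → ℂ) (k : ℕ → ℕ)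
    (s : Finset (Fin (R + 1) ⊕ Fin R)) : ℂ :=
  Matrix.det (Matrix.of (s.piecewise
    (rowsM Fin.succ (fun j : Fin (R + 1) => v (k j + (R - j)))
      (fun j : Fin R => v (k j + (R - 1 - j))))
    (rowsD Fin.succ (fun j : Fin (R + 1) => v (k j + (R - j)))
      (fun j : Fin R => v (k j + (R - 1 - j))))))

lemma DD_term (R : ℕ) (v : ℕ → Fin (R + 1) → ℂ) (k : ℕ → ℕ) (hk : Antitone k)
    (hk0 : ∀ i, R ≤ i → k i = 0) (t : ℕ) (a b : ℕ → ℕ)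
    (h1 : ∀ j < t, 1 ≤ a j ∧ a j ≤ b j ∧ b j ≤ R ∧ k (a j) < k (a j - 1) ∧
        k (b j) < k (b j - 1)) (h2 : ∀ i j, i < j → j < t → a i < a j ∧ b j < b i)
    (s : Finset (Fin (R + 1) ⊕ Fin R))
    (hs1 : ∀ x : Fin (R + 1), Sum.inl x ∈ s ↔ ∃ j < t, (x : ℕ) = b j)
    (hs2 : ∀ y : Fin R, Sum.inr y ∈ s ↔ ∃ j < t, (y : ℕ) = a j - 1) :
    DD R v k s = (-1) ^ t *
      (FF R v (iterOp AddOp t a b k) * GG R v (iterOp RemOp t a b k)) := by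
  obtain ⟨x, y, σ, σ', hs, hx1, hx2, hy1, hy2, hA, hB, -⟩ := iter_sort R k hk hk0 t a b h1 h2
  rcases Nat.eq_zero_or_pos t with rfl | htpos
  · have hse : s = ∅ := by
      apply Finset.eq_empty_of_forall_notMem
      rintro (z | z) hz
      · have := (hs1 z).1 hz; simp at this
      · have := (hs2 z).1 hz; simp at this
    subst hse
    unfold DD FF GG
    have hb : (Matrix.of ((∅ : Finset (Fin (R + 1) ⊕ Fin R)).piecewise
      (rowsM Fin.succ (fun j : Fin (R + 1) => v (k j + (R - j)))
        (fun j : Fin R => v (k j + (R - 1 - j))))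
      (rowsD Fin.succ (fun j : Fin (R + 1) => v (k j + (R - j)))
        (fun j : Fin R => v (k j + (R - 1 - j)))))) =
      Matrix.fromBlocks (Matrix.of fun j : Fin (R + 1) => v (k j + (R - j))) 0 0
        (Matrix.of fun j i : Fin R => v (k j + (R - 1 - j)) i.succ) := by
      ext z w
      rcases z with z | z <;> rcases w with w | w <;> simp [rowsD, topV, botV]
    rw [hb, Matrix.det_fromBlocks_zero₂₁]
    simp [iterOp]
  have hR : 0 < R := by have := h1 0 htpos; omega
  have : NeZero R := ⟨by omega⟩
  have hq : ∀ j < t, ((Fin.ofNat (R + 1) (b j) : Fin (R + 1)) : ℕ) = b j := fun j hj => by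
    have := h1 j hj
    simp [Fin.ofNat]; omega
  have hp : ∀ j < t, ((Fin.ofNat R (a j - 1) : Fin R) : ℕ) = a j - 1 := fun j hj => by
    have := h1 j hj
    simp only [Fin.ofNat]; exact Nat.mod_eq_of_lt (by omega)
  have hterm := pl_term (Fin.succ : Fin R → Fin (R + 1))
    (fun j : Fin (R + 1) => v (k j + (R - j)))
    (fun j : Fin R => v (k j + (R - 1 - j))) t (fun j => Fin.ofNat (R + 1) (b j))
    (fun j => Fin.ofNat R (a j - 1))
    (fun i hi j hj h => by
      have := congrArg Fin.val h
      simp only [hq i hi, hq j hj] at this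
      by_contra hne
      rcases Nat.lt_or_gt_of_ne hne with hlt | hlt
      · have := h2 _ _ hlt hj; omega
      · have := h2 _ _ hlt hi; omega)
    (fun i hi j hj h => by
      have := congrArg Fin.val h
      simp only [hp i hi, hp j hj] at this
      have := h1 i hi
      have := h1 j hj
      by_contra hne
      rcases Nat.lt_or_gt_of_ne hne with hlt | hlt
      · have := h2 _ _ hlt hj; omega
      · have := h2 _ _ hlt hi; omega)
    s
    (fun z => by
      rw [hs1]
      refine exists_congr fun j => and_congr_right fun hj => ?_
      rw [Fin.ext_iff, hq j hj])
    (fun z => by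
      rw [hs2]
      refine exists_congr fun j => and_congr_right fun hj => ?_
      rw [Fin.ext_iff, hp j hj])
    (fun j => v (x j)) (fun j => v (y j))
    (fun j hj => by simp only [hq j hj, hp j hj]; rw [hx1 j hj])
    (fun z hz => by
      show v (x z) = _
      rw [hx2 z]
      intro j hj h
      exact hz j hj (by rw [Fin.ext_iff, hq j hj, h]))
    (fun j hj => by simp only [hq j hj, hp j hj]; rw [hy1 j hj])
    (fun z hz => by
      show v (y z) = _
      rw [hy2 z]
      intro j hj h
      exact hz j hj (by rw [Fin.ext_iff, hp j hj, h]))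
  unfold DD
  rw [hterm]
  congr 1
  have hF : FF R v (iterOp AddOp t a b k) =
      ((Equiv.Perm.sign σ : ℤ) : ℂ) * Matrix.det (Matrix.of fun j : Fin (R + 1) => v (x j)) := by
    rw [← Matrix.det_permute]
    unfold FF
    congr 1
    ext j i
    simp [hA j]
  have hG : GG R v (iterOp RemOp t a b k) =
      ((Equiv.Perm.sign σ' : ℤ) : ℂ) *
        Matrix.det (Matrix.of fun j i : Fin R => v (y j) i.succ) := by
    rw [← Matrix.det_permute]
    unfold GG
    congr 1
    ext j i
    simp [hB j]
  rw [hF, hG, hs]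
  have hsq : ((Equiv.Perm.sign σ' : ℤ) : ℂ) * ((Equiv.Perm.sign σ' : ℤ) : ℂ) = 1 := by
    rw [← Int.cast_mul, ← Units.val_mul, Int.units_mul_self]; simp
  linear_combination (-Matrix.det (Matrix.of fun j : Fin (R + 1) => v (x j)) *
    Matrix.det (Matrix.of fun j i : Fin R => v (y j) i.succ)) * hsq

lemma DD_main (R : ℕ) (v : ℕ → Fin (R + 1) → ℂ) (k : ℕ → ℕ) (l : ℕ) (hR : 0 < R) (hl : l ≤ R)
    (hpos : ∀ i < l, 0 < k i) (T : Finset (Fin (R + 1) ⊕ Fin R))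
    (hT1 : ∀ x : Fin (R + 1), Sum.inl x ∈ T ↔ l ≤ (x : ℕ))
    (hT2 : ∀ y : Fin R, Sum.inr y ∈ T ↔ (y : ℕ) < l) :
    FF R v (fun i => if i < l then k i - 1 else k i) *
      GG R v (fun i => if i < l then k i + 1 else k i) = ∑ s ∈ T.powerset, DD R v k s := by
  unfold DD
  rw [← pl_expand]
  have : NeZero R := ⟨by omega⟩
  have hq : ∀ j < l, ((Fin.ofNat (R + 1) j : Fin (R + 1)) : ℕ) = j := fun j hj => by
    simp only [Fin.ofNat]; exact Nat.mod_eq_of_lt (by omega)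
  have hp : ∀ j < l, ((Fin.ofNat R j : Fin R) : ℕ) = j := fun j hj => by
    simp only [Fin.ofNat]; exact Nat.mod_eq_of_lt (by omega)
  symm
  apply pl_main (Fin.succ : Fin R → Fin (R + 1)) _ _ l (fun j => Fin.ofNat (R + 1) j)
    (fun j => Fin.ofNat R j)
  · intro i hi j hj h
    have := congrArg Fin.val h
    simpa only [hq i hi, hq j hj] using this
  · intro i hi j hj h
    have := congrArg Fin.val h
    simpa only [hp i hi, hp j hj] using this
  · intro x
    rw [hT1, ← not_lt, not_iff_not]
    constructor
    · intro h; exact ⟨x, h, by rw [Fin.ext_iff, hq _ h]⟩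
    · rintro ⟨j, hj, rfl⟩; rw [hq j hj]; exact hj
  · intro x
    rw [hT2]
    constructor
    · intro h; exact ⟨x, h, by rw [Fin.ext_iff, hp _ h]⟩
    · rintro ⟨j, hj, rfl⟩; rw [hp j hj]; exact hj
  · intro j hj
    simp only [hq j hj, hp j hj, if_pos hj]
    have := hpos j hj
    congr 1; omega
  · intro x hx
    dsimp only
    rw [if_neg]
    intro h
    exact hx x h (by rw [Fin.ext_iff, hq _ h])
  · intro j hj
    simp only [hq j hj, hp j hj, if_pos hj]
    congr 1; omega
  · intro x hx
    dsimp only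
    rw [if_neg]
    intro h
    exact hx x h (by rw [Fin.ext_iff, hp _ h])

section Assembly

variable (n : ℕ) (m rr : ℕ → ℕ)

open Classical in
/-- the set of moved rows attached to the corner sets `P`, `Q` -/
noncomputable def SPQ (R : ℕ) (rr : ℕ → ℕ) (P Q : Finset ℕ) : Finset (Fin (R + 1) ⊕ Fin R) :=
  Finset.univ.filter fun z => Sum.elim (fun x : Fin (R + 1) => ∃ q ∈ Q, (x : ℕ) = rr (q - 1))
    (fun y : Fin R => ∃ p ∈ P, (y : ℕ) + 1 = rr (p - 1)) z

lemma mem_SPQ_inl (R : ℕ) (P Q : Finset ℕ) (x : Fin (R + 1)) :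
    Sum.inl x ∈ SPQ R rr P Q ↔ ∃ q ∈ Q, (x : ℕ) = rr (q - 1) := by
  simp [SPQ]

lemma mem_SPQ_inr (R : ℕ) (P Q : Finset ℕ) (y : Fin R) :
    Sum.inr y ∈ SPQ R rr P Q ↔ ∃ p ∈ P, (y : ℕ) + 1 = rr (p - 1) := by
  simp [SPQ]

lemma rr_le_iff (hrr : ∀ j, j + 1 < n → rr j < rr (j + 1)) (i j : ℕ) (hi : i < n) (hj : j < n) :
    rr i ≤ rr j ↔ i ≤ j := by
  constructor
  · intro h
    by_contra hc
    have := rr_lt n rr hrr j i (by omega) hi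
    omega
  · intro h
    rcases Nat.lt_or_eq_of_le h with h | rfl
    · exact (rr_lt n rr hrr i j h hj).le
    · exact le_rfl

lemma rr_inj (hrr : ∀ j, j + 1 < n → rr j < rr (j + 1)) (i j : ℕ) (hi : i < n) (hj : j < n)
    (h : rr i = rr j) : i = j := by
  have h1 := (rr_le_iff n rr hrr i j hi hj).1 h.le
  have h2 := (rr_le_iff n rr hrr j i hj hi).1 h.ge
  omega

theorem assembly (hn : 1 ≤ n) 
    (hm : ∀ j, j + 1 < n → m (j + 1) < m j) (hmpos : 0 < m (n - 1))
    (hrr : ∀ j, j + 1 < n → rr j < rr (j + 1)) (hrrpos : 0 < rr 0)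
    (d : ℕ) (hd1 : 1 ≤ d) (hdn : d ≤ n) (R : ℕ) (hR : R = rr (n - 1))
    (v : ℕ → Fin (R + 1) → ℂ) :
    FF R v (fun i => if i < rr (d - 1) then stepPart n m rr i - 1 else stepPart n m rr i) *
      GG R v (fun i => if i < rr (d - 1) then stepPart n m rr i + 1 else stepPart n m rr i) =
    FF R v (stepPart n m rr) * GG R v (stepPart n m rr) +
      ∑ t ∈ Finset.Icc 1 (min d (n - d + 1)),
          ∑ P ∈ Finset.powersetCard t (Finset.Icc 1 d),
            ∑ Q ∈ Finset.powersetCard t (Finset.Icc d n),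
              (-1 : ℂ) ^ t * (FF R v
                  (iterOp AddOp t (fun i => rr (ascNth P i - 1))
                    (fun i => rr (ascNth Q (t - 1 - i) - 1)) (stepPart n m rr)) *
                GG R v
                  (iterOp RemOp t (fun i => rr (ascNth P i - 1))
                    (fun i => rr (ascNth Q (t - 1 - i) - 1)) (stepPart n m rr))) := by
  classical
  have hanti := stepPart_antitone n m rr hm hmpos hrr hrrpos
  have hdrop := stepPart_drop n m rr hm hmpos hrr hrrpos
  have hconst := stepPart_const n m rr
  have hrrR : ∀ j < n, rr j ≤ R := fun j hj => by
    rw [hR]; exact (rr_le_iff n rr hrr j (n - 1) hj (by omega)).2 (by omega)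
  have hzero : ∀ i, R ≤ i → stepPart n m rr i = 0 := fun i hi =>
    stepPart_zero n m rr i fun j hj => (hrrR j hj).trans hi
  have hrr1 : ∀ j < n, 1 ≤ rr j := fun j hj =>
    le_trans hrrpos ((rr_le_iff n rr hrr 0 j (by omega) hj).2 (by omega))
  have hRpos : 0 < R := by have := hrr1 (n - 1) (by omega); omega
  set k := stepPart n m rr with hkdef
  set l := rr (d - 1) with hl
  have hlR : l ≤ R := hrrR (d - 1) (by omega)
  have hpos : ∀ i < l, 0 < k i := fun i hi => by
    have h1 := hdrop (d - 1) (by omega)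
    have h2 : k (rr (d - 1) - 1) ≤ k i := hanti (by omega)
    omega
  set T : Finset (Fin (R + 1) ⊕ Fin R) := Finset.univ.filter fun z =>
    Sum.elim (fun x : Fin (R + 1) => l ≤ (x : ℕ)) (fun y : Fin R => (y : ℕ) < l) z with hT
  have hT1 : ∀ x : Fin (R + 1), Sum.inl x ∈ T ↔ l ≤ (x : ℕ) := fun x => by simp [hT]
  have hT2 : ∀ y : Fin R, Sum.inr y ∈ T ↔ (y : ℕ) < l := fun y => by simp [hT]
  rw [DD_main R v k l hRpos hlR hpos T hT1 hT2]
  -- membership facts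
  have hPm : ∀ p ∈ Finset.Icc 1 d, p - 1 < n ∧ rr (p - 1) ≤ l := fun p hp => by
    rw [Finset.mem_Icc] at hp
    exact ⟨by omega, (rr_le_iff n rr hrr _ _ (by omega) (by omega)).2 (by omega)⟩
  have hQm : ∀ q ∈ Finset.Icc d n, q - 1 < n ∧ l ≤ rr (q - 1) := fun q hq => by
    rw [Finset.mem_Icc] at hq
    exact ⟨by omega, (rr_le_iff n rr hrr _ _ (by omega) (by omega)).2 (by omega)⟩
  -- reindexing
  have hre : ∑ s ∈ T.powerset, DD R v k s =
      ∑ P ∈ (Finset.Icc 1 d).powerset, ∑ Q ∈ (Finset.Icc d n).powerset,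
        DD R v k (SPQ R rr P Q) := by
    rw [← Finset.sum_product']
    symm
    have hinj : Set.InjOn (fun pq : Finset ℕ × Finset ℕ => SPQ R rr pq.1 pq.2)
        (((Finset.Icc 1 d).powerset ×ˢ (Finset.Icc d n).powerset : Finset _) :
          Set (Finset ℕ × Finset ℕ)) := by
      rintro ⟨P, Q⟩ h ⟨P', Q'⟩ h' he
      simp only [Finset.coe_product, Set.mem_prod, Finset.mem_coe, Finset.mem_powerset] at h h'
      dsimp only at he
      have key1 : ∀ P Q P' Q' : Finset ℕ, P ⊆ Finset.Icc 1 d → P' ⊆ Finset.Icc 1 d →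
          SPQ R rr P Q = SPQ R rr P' Q' → P ⊆ P' := by
        intro P Q P' Q' h h' he p hp
        have h1 := hPm p (h hp)
        have h3 := hrr1 _ h1.1
        have hmem : Sum.inr (⟨rr (p - 1) - 1, by omega⟩ : Fin R) ∈ SPQ R rr P Q :=
          (mem_SPQ_inr rr R P Q _).2 ⟨p, hp, by simp; omega⟩
        rw [he, mem_SPQ_inr] at hmem
        obtain ⟨p', hp', he'⟩ := hmem
        simp only at he'
        have h2 := hPm p' (h' hp')
        have := rr_inj n rr hrr (p - 1) (p' - 1) h1.1 h2.1 (by omega)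
        have e1 := Finset.mem_Icc.1 (h hp)
        have e2 := Finset.mem_Icc.1 (h' hp')
        rwa [show p = p' by omega]
      have key2 : ∀ P Q P' Q' : Finset ℕ, Q ⊆ Finset.Icc d n → Q' ⊆ Finset.Icc d n →
          SPQ R rr P Q = SPQ R rr P' Q' → Q ⊆ Q' := by
        intro P Q P' Q' h h' he p hp
        have h1 := hQm p (h hp)
        have h3 := hrrR _ h1.1
        have hmem : Sum.inl (⟨rr (p - 1), by omega⟩ : Fin (R + 1)) ∈ SPQ R rr P Q :=
          (mem_SPQ_inl rr R P Q _).2 ⟨p, hp, rfl⟩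
        rw [he, mem_SPQ_inl] at hmem
        obtain ⟨p', hp', he'⟩ := hmem
        simp only at he'
        have h2 := hQm p' (h' hp')
        have := rr_inj n rr hrr (p - 1) (p' - 1) h1.1 h2.1 (by omega)
        have e1 := Finset.mem_Icc.1 (h hp)
        have e2 := Finset.mem_Icc.1 (h' hp')
        rwa [show p = p' by omega]
      rw [Prod.mk.injEq]
      exact ⟨(key1 P Q P' Q' h.1 h'.1 he).antisymm (key1 P' Q' P Q h'.1 h.1 he.symm),
        (key2 P Q P' Q' h.2 h'.2 he).antisymm (key2 P' Q' P Q h'.2 h.2 he.symm)⟩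
    rw [← Finset.sum_image (f := fun s => DD R v k s) hinj]
    apply Finset.sum_subset
    · intro s hs
      rw [Finset.mem_image] at hs
      obtain ⟨⟨P, Q⟩, h, rfl⟩ := hs
      rw [Finset.mem_product, Finset.mem_powerset, Finset.mem_powerset] at h
      rw [Finset.mem_powerset]
      rintro (x | y) hz
      · rw [mem_SPQ_inl] at hz
        obtain ⟨q, hq, hx⟩ := hz
        rw [hT1, hx]
        exact (hQm q (h.2 hq)).2
      · rw [mem_SPQ_inr] at hz
        obtain ⟨p, hp, hy⟩ := hz
        rw [hT2]
        have := (hPm p (h.1 hp)).2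
        omega
    · intro s hsT hs
      rw [Finset.mem_powerset] at hsT
      by_contra hne
      apply hs
      have hY : ∀ y : Fin R, Sum.inr y ∈ s → ∃ p ∈ Finset.Icc 1 d, (y : ℕ) + 1 = rr (p - 1) := by
        intro y hy
        have hyl := (hT2 y).1 (hsT hy)
        by_cases hex : ∃ p < n, (y : ℕ) + 1 = rr p
        · obtain ⟨p, hp, he⟩ := hex
          have : p ≤ d - 1 := (rr_le_iff n rr hrr p (d - 1) hp (by omega)).1 (by omega)
          exact ⟨p + 1, Finset.mem_Icc.2 ⟨by omega, by omega⟩, by simpa using he⟩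
        · push Not at hex
          exfalso
          apply hne
          have hyl' := hex (d - 1) (by omega)
          apply pl_vanishR _ _ _ s (⟨(y : ℕ) + 1, by omega⟩ : Fin (R + 1)) y _ hy
          · show v (k ((y : ℕ) + 1) + (R - ((y : ℕ) + 1))) = v (k y + (R - 1 - y))
            rw [hconst y hex]
            congr 2; omega
          · intro hmem
            have := (hT1 _).1 (hsT hmem)
            simp only at this
            omega
      have hX : ∀ x : Fin (R + 1), Sum.inl x ∈ s → ∃ q ∈ Finset.Icc d n, (x : ℕ) = rr (q - 1) := by
        intro x hx
        have hxl := (hT1 x).1 (hsT hx)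
        by_cases hex : ∃ p < n, (x : ℕ) = rr p
        · obtain ⟨p, hp, he⟩ := hex
          have : d - 1 ≤ p := (rr_le_iff n rr hrr (d - 1) p (by omega) hp).1 (by omega)
          exact ⟨p + 1, Finset.mem_Icc.2 ⟨by omega, by omega⟩, by simpa using he⟩
        · push Not at hex
          exfalso
          apply hne
          have hxl' := hex (d - 1) (by omega)
          have hx2 := x.2
          have hl1 := hrr1 (d - 1) (by omega)
          obtain ⟨y, hy⟩ : ∃ y, (x : ℕ) = y + 1 := ⟨x - 1, by omega⟩
          rw [hy] at hex
          apply pl_vanishL _ _ _ s x (⟨y, by omega⟩ : Fin R) hx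
          · intro hmem
            have := (hT2 _).1 (hsT hmem)
            simp only at this
            omega
          · show v (k x + (R - x)) = v (k y + (R - 1 - y))
            rw [hy, hconst y hex]
            congr 2; omega
      rw [Finset.mem_image]
      refine ⟨((Finset.Icc 1 d).filter fun p => ∃ y : Fin R, Sum.inr y ∈ s ∧ (y : ℕ) + 1 = rr (p - 1),
        (Finset.Icc d n).filter fun q => ∃ x : Fin (R + 1), Sum.inl x ∈ s ∧ (x : ℕ) = rr (q - 1)),
        ?_, ?_⟩
      · rw [Finset.mem_product, Finset.mem_powerset, Finset.mem_powerset]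
        exact ⟨Finset.filter_subset _ _, Finset.filter_subset _ _⟩
      · ext z
        rcases z with x | y
        · rw [mem_SPQ_inl]
          constructor
          · rintro ⟨q, hq, he⟩
            obtain ⟨-, x', hx', he'⟩ := Finset.mem_filter.1 hq
            rwa [show x = x' from Fin.ext (by omega)]
          · intro hx
            obtain ⟨q, hq, he⟩ := hX x hx
            exact ⟨q, Finset.mem_filter.2 ⟨hq, x, hx, he⟩, he⟩
        · rw [mem_SPQ_inr]
          constructor
          · rintro ⟨q, hq, he⟩
            obtain ⟨-, x', hx', he'⟩ := Finset.mem_filter.1 hq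
            rwa [show y = x' from Fin.ext (by omega)]
          · intro hx
            obtain ⟨q, hq, he⟩ := hY y hx
            exact ⟨q, Finset.mem_filter.2 ⟨hq, y, hx, he⟩, he⟩
  -- cardinalities
  have hcard : ∀ P ⊆ Finset.Icc 1 d, ∀ Q ⊆ Finset.Icc d n, P.card ≠ Q.card →
      DD R v k (SPQ R rr P Q) = 0 := by
    intro P hP Q hQ hne
    by_contra hc
    have h := pl_card _ _ _ _ hc
    have hL : Q.card = (SPQ R rr P Q).toLeft.card := by
      apply Finset.card_bij (fun q hq => (⟨rr (q - 1), by
        have := hrrR _ (hQm q (hQ hq)).1; omega⟩ : Fin (R + 1)))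
      · intro q hq
        rw [Finset.mem_toLeft, mem_SPQ_inl]
        exact ⟨q, hq, rfl⟩
      · intro q hq q' hq' he
        have := rr_inj n rr hrr _ _ (hQm q (hQ hq)).1 (hQm q' (hQ hq')).1 (congrArg Fin.val he)
        have e1 := Finset.mem_Icc.1 (hQ hq)
        have e2 := Finset.mem_Icc.1 (hQ hq')
        omega
      · intro x hx
        rw [Finset.mem_toLeft, mem_SPQ_inl] at hx
        obtain ⟨q, hq, he⟩ := hx
        exact ⟨q, hq, Fin.ext he.symm⟩
    have hRr : P.card = (SPQ R rr P Q).toRight.card := by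
      apply Finset.card_bij (fun p hp => (⟨rr (p - 1) - 1, by
        have := hrrR _ (hPm p (hP hp)).1; omega⟩ : Fin R))
      · intro p hp
        rw [Finset.mem_toRight, mem_SPQ_inr]
        have := hrr1 _ (hPm p (hP hp)).1
        exact ⟨p, hp, by simp only; omega⟩
      · intro q hq q' hq' he
        have h3 := hrr1 _ (hPm q (hP hq)).1
        have h4 := hrr1 _ (hPm q' (hP hq')).1
        have h5 := congrArg Fin.val he
        simp only at h5
        have := rr_inj n rr hrr _ _ (hPm q (hP hq)).1 (hPm q' (hP hq')).1 (by omega)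
        have e1 := Finset.mem_Icc.1 (hP hq)
        have e2 := Finset.mem_Icc.1 (hP hq')
        omega
      · intro x hx
        rw [Finset.mem_toRight, mem_SPQ_inr] at hx
        obtain ⟨q, hq, he⟩ := hx
        exact ⟨q, hq, Fin.ext (by simp only; omega)⟩
    omega
  -- individual terms
  have hterm : ∀ t, ∀ P ∈ Finset.powersetCard t (Finset.Icc 1 d),
      ∀ Q ∈ Finset.powersetCard t (Finset.Icc d n), DD R v k (SPQ R rr P Q) =
      (-1 : ℂ) ^ t * (FF R v (iterOp AddOp t (fun i => rr (ascNth P i - 1))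
                    (fun i => rr (ascNth Q (t - 1 - i) - 1)) k) *
                GG R v (iterOp RemOp t (fun i => rr (ascNth P i - 1))
                    (fun i => rr (ascNth Q (t - 1 - i) - 1)) k)) := by
    intro t P hP Q hQ
    obtain ⟨hP, hPc⟩ := Finset.mem_powersetCard.1 hP
    obtain ⟨hQ, hQc⟩ := Finset.mem_powersetCard.1 hQ
    have hPa : ∀ j < t, ascNth P j ∈ P := fun j hj => ascNth_mem P j (by omega)
    have hQa : ∀ j < t, ascNth Q (t - 1 - j) ∈ Q := fun j hj => ascNth_mem Q _ (by omega)
    apply DD_term R v k hanti hzero t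
    · intro j hj
      have h1 := hPm _ (hP (hPa j hj))
      have h2 := hQm _ (hQ (hQa j hj))
      exact ⟨hrr1 _ h1.1, h1.2.trans h2.2, hrrR _ h2.1, hdrop _ h1.1, hdrop _ h2.1⟩
    · intro i j hij hj
      have h1 := hPm _ (hP (hPa j hj))
      have h2 := hQm _ (hQ (hQa i (by omega)))
      have e1 := Finset.mem_Icc.1 (hP (hPa i (by omega)))
      have e2 := Finset.mem_Icc.1 (hQ (hQa j hj))
      have e3 := ascNth_lt P i j hij (by omega)
      have e4 := ascNth_lt Q (t - 1 - j) (t - 1 - i) (by omega) (by omega)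
      exact ⟨rr_lt n rr hrr _ _ (by omega) h1.1, rr_lt n rr hrr _ _ (by omega) h2.1⟩
    · intro x
      rw [mem_SPQ_inl]
      constructor
      · rintro ⟨q, hq, he⟩
        obtain ⟨j, hj, rfl⟩ := ascNth_surj Q q hq
        refine ⟨t - 1 - j, by omega, ?_⟩
        rw [show t - 1 - (t - 1 - j) = j by omega]
        exact he
      · rintro ⟨j, hj, he⟩
        exact ⟨_, hQa j hj, he⟩
    · intro y
      rw [mem_SPQ_inr]
      constructor
      · rintro ⟨q, hq, he⟩
        obtain ⟨j, hj, rfl⟩ := ascNth_surj P q hq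
        exact ⟨j, by omega, by omega⟩
      · rintro ⟨j, hj, he⟩
        have := hrr1 _ (hPm _ (hP (hPa j hj))).1
        exact ⟨_, hPa j hj, by omega⟩
  rw [hre, Finset.sum_powerset]
  have hin : ∀ t, ∑ P ∈ Finset.powersetCard t (Finset.Icc 1 d),
      ∑ Q ∈ (Finset.Icc d n).powerset, DD R v k (SPQ R rr P Q) =
      ∑ P ∈ Finset.powersetCard t (Finset.Icc 1 d),
            ∑ Q ∈ Finset.powersetCard t (Finset.Icc d n),
      (-1 : ℂ) ^ t * (FF R v (iterOp AddOp t (fun i => rr (ascNth P i - 1))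
                    (fun i => rr (ascNth Q (t - 1 - i) - 1)) k) *
                GG R v (iterOp RemOp t (fun i => rr (ascNth P i - 1))
                    (fun i => rr (ascNth Q (t - 1 - i) - 1)) k)) := by
    intro t
    apply Finset.sum_congr rfl
    intro P hP
    rw [← Finset.sum_congr rfl (hterm t P hP)]
    symm
    apply Finset.sum_subset
    · intro Q hQ
      exact Finset.mem_powerset.2 (Finset.mem_powersetCard.1 hQ).1
    · intro Q hQ hQn
      rw [Finset.mem_powerset] at hQ
      obtain ⟨hP, hPc⟩ := Finset.mem_powersetCard.1 hP
      apply hcard P hP Q hQ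
      intro h
      exact hQn (Finset.mem_powersetCard.2 ⟨hQ, by omega⟩)
  rw [Finset.sum_congr rfl fun t _ => hin t, Nat.card_Icc, Finset.sum_range_succ']
  rw [add_comm]
  congr 1
  · simp [iterOp]
  · rw [← Finset.sum_image (s := Finset.range (d + 1 - 1)) (g := fun t => t + 1)
      (f := fun t => ∑ P ∈ Finset.powersetCard t (Finset.Icc 1 d),
            ∑ Q ∈ Finset.powersetCard t (Finset.Icc d n),
      (-1 : ℂ) ^ t * (FF R v (iterOp AddOp t (fun i => rr (ascNth P i - 1))
                    (fun i => rr (ascNth Q (t - 1 - i) - 1)) k) *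
                GG R v (iterOp RemOp t (fun i => rr (ascNth P i - 1))
                    (fun i => rr (ascNth Q (t - 1 - i) - 1)) k))) (by
        intro x _ y _ h; simpa using h)]
    symm
    apply Finset.sum_subset
    · intro t ht
      rw [Finset.mem_Icc] at ht
      rw [Finset.mem_image]
      exact ⟨t - 1, Finset.mem_range.2 (by omega), by omega⟩
    · intro t ht htn
      rw [Finset.mem_image] at ht
      obtain ⟨t', ht', rfl⟩ := ht
      rw [Finset.mem_range] at ht'
      rw [Finset.mem_Icc] at htn
      apply Finset.sum_eq_zero
      intro P _
      rw [Finset.powersetCard_eq_empty.2, Finset.sum_empty]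
      rw [Nat.card_Icc]
      omega

end Assembly

/-- Plücker-type relation for truncated Schur multiple zeta values (Corollary 5.4(1)). -/
theorem plucker_truncated_schur_zeta (M : ℕ) (hM : 0 < M) (a : ℤ → ℂ)
    (n : ℕ) (hn : 1 ≤ n) (m rr : ℕ → ℕ)
    (hm : ∀ j, j + 1 < n → m (j + 1) < m j) (hmpos : 0 < m (n - 1))
    (hrr : ∀ j, j + 1 < n → rr j < rr (j + 1)) (hrrpos : 0 < rr 0)
    (d : ℕ) (hd1 : 1 ≤ d) (hdn : d ≤ n) :
    zetaT M (rr (n - 1) + n) (stepPart n m rr) (fun _ => 0) a *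
        zetaT M (rr (n - 1) + n) (stepPart n m rr) (fun _ => 0) (fun c => a (c - 1)) =
      zetaT M (rr (n - 1) + n)
          (fun i => if i < rr (d - 1) then stepPart n m rr i - 1 else stepPart n m rr i)
          (fun _ => 0) a *
        zetaT M (rr (n - 1) + n)
          (fun i => if i < rr (d - 1) then stepPart n m rr i + 1 else stepPart n m rr i)
          (fun _ => 0) (fun c => a (c - 1)) +
      ∑ t ∈ Finset.Icc 1 (min d (n - d + 1)),
        (-1 : ℂ) ^ (t - 1) *
          ∑ P ∈ Finset.powersetCard t (Finset.Icc 1 d),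
            ∑ Q ∈ Finset.powersetCard t (Finset.Icc d n),
              zetaT M (rr (n - 1) + n)
                  (iterOp AddOp t (fun i => rr (ascNth P i - 1))
                    (fun i => rr (ascNth Q (t - 1 - i) - 1)) (stepPart n m rr))
                  (fun _ => 0) a *
                zetaT M (rr (n - 1) + n)
                  (iterOp RemOp t (fun i => rr (ascNth P i - 1))
                    (fun i => rr (ascNth Q (t - 1 - i) - 1)) (stepPart n m rr))
                  (fun _ => 0) (fun c => a (c - 1)) := by
  classical
  have hrr1 : ∀ j < n, 1 ≤ rr j := fun j hj =>
    le_trans hrrpos ((rr_le_iff n rr hrr 0 j (by omega) hj).2 (by omega))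
  have hanti := stepPart_antitone n m rr hm hmpos hrr hrrpos
  have hdrop := stepPart_drop n m rr hm hmpos hrr hrrpos
  obtain ⟨R, hR⟩ : ∃ R, R = rr (n - 1) := ⟨_, rfl⟩
  have hrrR : ∀ j < n, rr j ≤ R := fun j hj => by
    rw [hR]; exact (rr_le_iff n rr hrr j (n - 1) hj (by omega)).2 (by omega)
  have hzero : ∀ i, R ≤ i → stepPart n m rr i = 0 := fun i hi =>
    stepPart_zero n m rr i fun j hj => (hrrR j hj).trans hi
  rw [← hR]
  set g : ℕ → ℕ → ℂ := fun k s => (k : ℂ) ^ (-(a ((s : ℤ) - R))) with hg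
  set v : ℕ → Fin (R + 1) → ℂ := fun s i => VVm g M s (R - i) with hv
  have hF : ∀ lam : ℕ → ℕ, Antitone lam → (∀ i, R + 1 ≤ i → lam i = 0) →
      zetaT M (R + n) lam (fun _ => 0) a = FF R v lam := by
    intro lam h1 h2
    rw [zetaT_eq_det M (R + n) (R + 1) (by omega) g a (fun k s => by
      simp only [hg]; congr 3; push_cast; ring) lam h1 h2]
    rfl
  have hG : ∀ lam : ℕ → ℕ, Antitone lam → (∀ i, R ≤ i → lam i = 0) →
      zetaT M (R + n) lam (fun _ => 0) (fun c => a (c - 1)) = GG R v lam := by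
    intro lam h1 h2
    rw [zetaT_eq_det M (R + n) R (by omega) g (fun c => a (c - 1)) (fun k s => by
      simp only [hg]; congr 3; ring) lam h1 h2]
    unfold GG
    congr 1
    ext j i
    simp only [Matrix.of_apply, hv, Fin.val_succ]
    congr 1
    omega
  have hl : rr (d - 1) ≤ R := hrrR (d - 1) (by omega)
  have hd := hdrop (d - 1) (by omega)
  have hl1 := hrr1 (d - 1) (by omega)
  have hmain := assembly n m rr hn hm hmpos hrr hrrpos d hd1 hdn R hR v
  rw [hF _ hanti (fun i hi => hzero i (by omega)), hG _ hanti hzero,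
    hF (fun i => if i < rr (d - 1) then stepPart n m rr i - 1 else stepPart n m rr i),
    hG (fun i => if i < rr (d - 1) then stepPart n m rr i + 1 else stepPart n m rr i), hmain]
  · rw [add_assoc, left_eq_add, ← Finset.sum_add_distrib]
    apply Finset.sum_eq_zero
    intro t ht
    rw [Finset.mem_Icc] at ht
    rw [Finset.mul_sum, ← Finset.sum_add_distrib]
    apply Finset.sum_eq_zero
    intro P hP
    rw [Finset.mul_sum, ← Finset.sum_add_distrib]
    apply Finset.sum_eq_zero
    intro Q hQ
    obtain ⟨hP, hPc⟩ := Finset.mem_powersetCard.1 hP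
    obtain ⟨hQ, hQc⟩ := Finset.mem_powersetCard.1 hQ
    have hPa : ∀ j < t, ascNth P j ∈ Finset.Icc 1 d := fun j hj => hP (ascNth_mem P j (by omega))
    have hQa : ∀ j < t, ascNth Q (t - 1 - j) ∈ Finset.Icc d n := fun j hj =>
      hQ (ascNth_mem Q _ (by omega))
    obtain ⟨x, y, σ, σ', -, -, -, -, -, -, -, hA, hB, hA0, hB0, -⟩ :=
      iter_sort R (stepPart n m rr) hanti hzero t (fun i => rr (ascNth P i - 1))
        (fun i => rr (ascNth Q (t - 1 - i) - 1))
        (fun j hj => by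
          have h1 := Finset.mem_Icc.1 (hPa j hj)
          have h2 := Finset.mem_Icc.1 (hQa j hj)
          exact ⟨hrr1 _ (by omega), (rr_le_iff n rr hrr _ _ (by omega) (by omega)).2 (by omega),
            hrrR _ (by omega), hdrop _ (by omega), hdrop _ (by omega)⟩)
        (fun i j hij hj => by
          have h1 := Finset.mem_Icc.1 (hPa j hj)
          have h2 := Finset.mem_Icc.1 (hQa i (by omega))
          have e1 := Finset.mem_Icc.1 (hPa i (by omega))
          have e2 := Finset.mem_Icc.1 (hQa j hj)
          have e3 := ascNth_lt P i j hij (by omega)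
          have e4 := ascNth_lt Q (t - 1 - j) (t - 1 - i) (by omega) (by omega)
          exact ⟨rr_lt n rr hrr _ _ (by omega) (by omega), rr_lt n rr hrr _ _ (by omega) (by omega)⟩)
    rw [hF _ hA hA0, hG _ hB hB0]
    obtain ⟨t', rfl⟩ : ∃ t', t = t' + 1 := ⟨t - 1, by omega⟩
    rw [Nat.add_sub_cancel, pow_succ]
    ring
  · apply antitone_nat_of_succ_le
    intro i
    have h1 : stepPart n m rr (i + 1) ≤ stepPart n m rr i := hanti (Nat.le_succ i)
    split_ifs <;> omega
  · intro i hi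
    rw [if_neg (by omega)]
    exact hzero i hi
  · apply antitone_nat_of_succ_le
    intro i
    have h1 : stepPart n m rr (i + 1) ≤ stepPart n m rr i := hanti (Nat.le_succ i)
    by_cases h2 : i + 1 = rr (d - 1)
    · rw [← h2, Nat.add_sub_cancel] at hd
      rw [h2, if_neg (by omega), if_pos (by omega), ← h2]
      omega
    · split_ifs <;> omega
  · intro i hi
    rw [if_neg (by omega)]
    exact hzero i (by omega)
end
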